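/- arXiv:1310.1417 — 4 statements merged into one kernel-verified Lean document; each statement's English description precedes it below -/
import Mathlib

section
/- Let n ≥ 3 and let p_1, …, p_{n−1} be integers, each at least 2. Suppose Γ is a finite group generated by involutions ρ_0, …, ρ_{n−1} with (ρ_i ρ_j)² = 1 whenever |i − j| ≥ 2, satisfying the intersection condition, such that ρ_{i−1}ρ_i has order p_i for 1 ≤ i ≤ n−1, |Γ| = 2 p_1 ⋯ p_{n−1}, and the subgroup generated by ρ_0ρ_1, …, ρ_{n−2}ρ_{n−1} has index 2 in Γ. Then the tuple (p_1, …, p_{n−1}) is admissible. -/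
/-- The intersection condition for a group generated by `n` involutions. -/
def interCond {G : Type*} [Group G] {n : ℕ} (ρ : Fin n → G) : Prop :=
  ∀ I J : Set (Fin n),
    Subgroup.closure (ρ '' I) ⊓ Subgroup.closure (ρ '' J) = Subgroup.closure (ρ '' (I ∩ J))

/-- Admissibility of the tuple `(p_1, …, p_{n-1})`: whenever `p i` is odd,
each of `p (i-1)` and `p (i+1)` (insofar as defined) is even and divides `2 * p i`. -/
def Admissible (n : ℕ) (p : ℕ → ℕ) : Prop :=
  ∀ i : ℕ, 1 ≤ i → i ≤ n - 1 → Odd (p i) →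
    (2 ≤ i → Even (p (i - 1)) ∧ p (i - 1) ∣ 2 * p i) ∧
    (i + 1 ≤ n - 1 → Even (p (i + 1)) ∧ p (i + 1) ∣ 2 * p i)

section Commutator

open scoped commutatorElement

/-- A product of two cyclic subgroups is metabelian: the commutators of powers of the two
generators generate an abelian normal subgroup. -/
theorem exists_normal_abelian_of_mul_zpow {G : Type*} [Group G] {x y : G}
    (hG : ∀ g : G, ∃ i j : ℤ, g = x ^ i * y ^ j) :
    ∃ U : Subgroup G, U.Normal ∧ (∀ u ∈ U, ∀ v ∈ U, u * v = v * u) ∧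
      ∀ i j : ℤ, ⁅x ^ i, y ^ j⁆ ∈ U := by
  have hG' : ∀ g : G, ∃ i j : ℤ, g = y ^ i * x ^ j := fun g => by
    obtain ⟨i, j, h⟩ := hG g⁻¹
    exact ⟨-j, -i, by rw [← inv_inv g, h]; group⟩
  have hy : ∀ l i : ℤ, ∃ s : ℤ, ∀ j : ℤ, y ^ l * ⁅x ^ i, y ^ j⁆ * (y ^ l)⁻¹ = ⁅x ^ s, y ^ j⁆ := by
    intro l i
    obtain ⟨s, t, h⟩ := hG (y ^ l * x ^ i * (y ^ l)⁻¹)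
    refine ⟨s, fun j => ?_⟩
    calc y ^ l * ⁅x ^ i, y ^ j⁆ * (y ^ l)⁻¹
        = (y ^ l * x ^ i * (y ^ l)⁻¹) * y ^ j * (y ^ l * x ^ i * (y ^ l)⁻¹)⁻¹ * (y ^ j)⁻¹ := by
          rw [commutatorElement_def]; group
      _ = ⁅x ^ s, y ^ j⁆ := by rw [h, commutatorElement_def]; group
  have hx : ∀ k j : ℤ, ∃ t : ℤ, ∀ i : ℤ, x ^ k * ⁅x ^ i, y ^ j⁆ * (x ^ k)⁻¹ = ⁅x ^ i, y ^ t⁆ := by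
    intro k j
    obtain ⟨t, s, h⟩ := hG' (x ^ k * y ^ j * (x ^ k)⁻¹)
    refine ⟨t, fun i => ?_⟩
    calc x ^ k * ⁅x ^ i, y ^ j⁆ * (x ^ k)⁻¹
        = x ^ i * (x ^ k * y ^ j * (x ^ k)⁻¹) * (x ^ i)⁻¹ * (x ^ k * y ^ j * (x ^ k)⁻¹)⁻¹ := by
          rw [commutatorElement_def]; group
      _ = ⁅x ^ i, y ^ t⁆ := by rw [h, commutatorElement_def]; group
  set S : Set G := {g | ∃ i j : ℤ, g = ⁅x ^ i, y ^ j⁆} with hS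
  have hSS : ∀ a ∈ S, ∀ b ∈ S, b * a = a * b := by
    rintro _ ⟨i, j, rfl⟩ _ ⟨k, l, rfl⟩
    obtain ⟨s, hs⟩ := hy (-l) i
    obtain ⟨t, ht⟩ := hx (-k) j
    have h : x ^ (-k) * (y ^ (-l) * ⁅x ^ i, y ^ j⁆ * (y ^ (-l))⁻¹) * (x ^ (-k))⁻¹ =
        y ^ (-l) * (x ^ (-k) * ⁅x ^ i, y ^ j⁆ * (x ^ (-k))⁻¹) * (y ^ (-l))⁻¹ := by
      rw [hs, ht, ht, hs]
    generalize ⁅x ^ i, y ^ j⁆ = c at h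
    rw [commutatorElement_def]
    rw [zpow_neg, zpow_neg] at h
    generalize x ^ k = a at h ⊢
    generalize y ^ l = b at h ⊢
    calc a * b * a⁻¹ * b⁻¹ * c
        = a * b * (a⁻¹ * (b⁻¹ * c * b⁻¹⁻¹) * a⁻¹⁻¹) * a⁻¹ * b⁻¹ := by group
      _ = c * (a * b * a⁻¹ * b⁻¹) := by rw [h]; group
  refine ⟨Subgroup.closure S, ⟨fun n hn g => ?_⟩, ?_, fun i j => Subgroup.subset_closure ⟨i, j, rfl⟩⟩
  · induction hn using Subgroup.closure_induction with
    | mem n hn =>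
      obtain ⟨i, j, rfl⟩ := hn
      obtain ⟨k, l, rfl⟩ := hG g
      obtain ⟨s, hs⟩ := hy l i
      obtain ⟨t, ht⟩ := hx k j
      refine Subgroup.subset_closure ⟨s, t, ?_⟩
      rw [← ht, ← hs]; group
    | one => simp
    | mul a b _ _ ha hb => rw [← conj_mul]; exact mul_mem ha hb
    | inv a _ ha => rw [← conj_inv]; exact inv_mem ha
  · intro u hu v hv
    have h1 : S ⊆ Subgroup.centralizer S := fun a ha =>
      Subgroup.mem_centralizer_iff.2 fun b hb => hSS a ha b hb
    have h2 := Subgroup.closure_le_centralizer_centralizer S hv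
    have h3 : Subgroup.closure S ≤ Subgroup.centralizer S := (Subgroup.closure_le _).2 h1
    exact Subgroup.mem_centralizer_iff.1 h2 u (h3 hu)

/-- If a finite group is the product of the cyclic subgroups generated by `x` and `y`, where `x` has
odd order, `(x * y) ^ 2 = 1`, and some endomorphism inverts both `x` and `y`, then `x` commutes
with `y ^ 2`. -/
theorem commute_sq_of_mul_zpow {G : Type*} [Group G] [Finite G] {x y : G}
    (hG : ∀ g : G, ∃ i j : ℤ, g = x ^ i * y ^ j) (φ : G →* G)
    (hφx : φ x = x⁻¹) (hφy : φ y = y⁻¹) (hxy : (x * y) ^ 2 = 1) (hx : Odd (orderOf x)) :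
    Commute x (y ^ 2) := by
  induction hm : Nat.card G using Nat.strong_induction_on generalizing G with
  | _ m ih =>
  obtain ⟨U, hU, hUc, hUxy⟩ := exists_normal_abelian_of_mul_zpow hG
  have hconj : ∀ g : G, g * x * g⁻¹ * x⁻¹ ∈ U := by
    intro g
    obtain ⟨i, j, rfl⟩ := hG g
    have h := hU.conj_mem _ (inv_mem (hUxy 1 j)) (x ^ i)
    rw [commutatorElement_def] at h
    convert h using 1
    group
  have hsq : x ^ 2 * y ^ 2 ∈ U := by
    have h := hU.conj_mem _ (hUxy 1 1) x
    have h2 : x ^ 2 * y ^ 2 = x * ⁅x ^ (1 : ℤ), y ^ (1 : ℤ)⁆ * x⁻¹ * (x * y) ^ 2 := by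
      simp only [commutatorElement_def, zpow_one, pow_two]; group
    rwa [h2, hxy, mul_one]
  set N : Subgroup G := U ⊓ Subgroup.centralizer {x} with hN
  have memN : ∀ g, g ∈ N ↔ g ∈ U ∧ Commute x g := fun g => by
    rw [hN, Subgroup.mem_inf, Subgroup.mem_centralizer_singleton_iff]
    exact and_congr_right fun _ => ⟨fun h => h.symm, fun h => h.symm⟩
  have hφN : ∀ g ∈ N, φ g = g⁻¹ := by
    intro g hg
    obtain ⟨-, hg⟩ := (memN g).1 hg
    obtain ⟨i, j, rfl⟩ := hG g
    have h : Commute (x ^ i) (x ^ i * y ^ j) := hg.zpow_left i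
    have h' : x ^ i * y ^ j = y ^ j * x ^ i := by
      have := h.eq
      rw [mul_assoc (x ^ i) (y ^ j)] at this
      exact mul_left_cancel this
    rw [map_mul, map_zpow, map_zpow, hφx, hφy, h', mul_inv_rev, inv_zpow, inv_zpow]
  by_cases hbot : N = ⊥
  · -- conjugation by `U` is transitive on the coset `U * x`, which meets `zpowers y`
    let f : U → U := fun u => ⟨u * x * (u : G)⁻¹ * x⁻¹, hconj u⟩
    have hf : Function.Injective f := by
      rintro ⟨u, hu⟩ ⟨v, hv⟩ huv
      have h : u * x * u⁻¹ * x⁻¹ = v * x * v⁻¹ * x⁻¹ := congrArg Subtype.val huv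
      have hmem : v⁻¹ * u ∈ N := by
        refine (memN _).2 ⟨mul_mem (inv_mem hv) hu, ?_⟩
        have h' : u * x * u⁻¹ = v * x * v⁻¹ := mul_right_cancel h
        have : x = v⁻¹ * u * x * (v⁻¹ * u)⁻¹ := by
          calc x = v⁻¹ * (v * x * v⁻¹) * v := by group
            _ = v⁻¹ * u * x * (v⁻¹ * u)⁻¹ := by rw [← h']; group
        exact mul_inv_eq_iff_eq_mul.1 this.symm |>.symm
      rw [hbot, Subgroup.mem_bot, inv_mul_eq_one] at hmem
      exact Subtype.ext hmem.symm
    obtain ⟨k, hk⟩ := hx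
    have hw : y ^ (2 * k) * x⁻¹ ∈ U := by
      have hcomm : Commute (x : G ⧸ U) (y : G ⧸ U) := by
        have h := hUxy 1 1
        rw [zpow_one, zpow_one, ← QuotientGroup.eq_one_iff] at h
        exact commutatorElement_eq_one_iff_commute.1 h
      have h1 : (x : G ⧸ U) ^ 2 * (y : G ⧸ U) ^ 2 = 1 := (QuotientGroup.eq_one_iff _).2 hsq
      have h2 : (x : G ⧸ U) ^ (2 * k) * (y : G ⧸ U) ^ (2 * k) = 1 := by
        rw [pow_mul, pow_mul, ← (hcomm.pow_pow 2 2).mul_pow, h1, one_pow]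
      have h3 : (x : G ⧸ U) ^ (2 * k) * (x : G ⧸ U) = 1 := by
        have h := pow_orderOf_eq_one x
        rw [hk, pow_succ] at h
        exact congrArg (QuotientGroup.mk (s := U)) h
      rw [← QuotientGroup.eq_one_iff]
      change (y : G ⧸ U) ^ (2 * k) * (x : G ⧸ U)⁻¹ = 1
      rw [mul_inv_eq_one]
      exact mul_left_cancel (h2.trans h3.symm)
    obtain ⟨⟨u, hu⟩, huw⟩ := (Finite.injective_iff_surjective.1 hf) ⟨_, hw⟩
    have huw' : u * x * u⁻¹ * x⁻¹ = y ^ (2 * k) * x⁻¹ := congrArg Subtype.val huw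
    have h1 : u * x * u⁻¹ = y ^ (2 * k) := mul_right_cancel huw'
    obtain ⟨i, j, hij⟩ := hG u⁻¹
    have hxk : x = y ^ (2 * k) := by
      have hu' : u = y ^ (-j) * x ^ (-i) := by rw [← inv_inv u, hij]; group
      rw [hu'] at h1
      calc x = y ^ j * (y ^ (-j) * x ^ (-i) * x * (y ^ (-j) * x ^ (-i))⁻¹) * y ^ (-j) := by group
        _ = y ^ (2 * k) := by rw [h1]; group
    rw [hxk]
    exact Commute.pow_pow_self y _ _
  · have hNn : N.Normal := by
      refine ⟨fun n hn g => ?_⟩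
      obtain ⟨hnU, hnx⟩ := (memN n).1 hn
      refine (memN _).2 ⟨hU.conj_mem _ hnU g, ?_⟩
      have h1 : Commute (g⁻¹ * x * g * x⁻¹) n := by
        have := hUc _ (hconj g⁻¹) _ hnU
        rwa [inv_inv] at this
      have h2 : Commute (g⁻¹ * x * g) n := by
        have := h1.mul_left hnx
        rwa [inv_mul_cancel_right] at this
      have h3 := (Commute.conj_iff g).2 h2
      convert h3 using 1
      group
    have hlt : Nat.card (G ⧸ N) < m := by
      rw [← hm, Subgroup.card_eq_card_quotient_mul_card_subgroup N]
      exact lt_mul_of_one_lt_right Nat.card_pos ((Subgroup.one_lt_card_iff_ne_bot N).2 hbot)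
    have hle : N ≤ N.comap φ := fun g hg => by
      rw [Subgroup.mem_comap, hφN g hg]; exact inv_mem hg
    have hquot : Commute (x : G ⧸ N) ((y : G ⧸ N) ^ 2) := by
      refine ih _ hlt ?_ (QuotientGroup.map N N φ hle) ?_ ?_ ?_ ?_ rfl
      · intro g
        induction g using QuotientGroup.induction_on with
        | H g =>
          obtain ⟨i, j, rfl⟩ := hG g
          exact ⟨i, j, rfl⟩
      · rw [QuotientGroup.map_mk, hφx]; rfl
      · rw [QuotientGroup.map_mk, hφy]; rfl
      · exact congrArg (QuotientGroup.mk (s := N)) hxy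
      · exact hx.of_dvd_nat (orderOf_map_dvd (QuotientGroup.mk' N) x)
    obtain ⟨n, hn⟩ : ∃ n, n = ⁅x, y ^ 2⁆ := ⟨_, rfl⟩
    have hnN : n ∈ N := by
      rw [← QuotientGroup.eq_one_iff, hn]
      exact commutatorElement_eq_one_iff_commute.2 hquot
    obtain ⟨hnU, hnx⟩ := (memN n).1 hnN
    have hny : Commute (y ^ 2) n := by
      have h : Commute (x ^ 2 * y ^ 2) n := hUc _ hsq _ hnU
      have h' := (hnx.pow_left 2).inv_left.mul_left h
      rwa [inv_mul_cancel_left] at h'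
    have hnp : n ^ orderOf x = 1 := by
      have h1 : y ^ 2 * x⁻¹ * (y ^ 2)⁻¹ = x⁻¹ * n := by rw [hn, commutatorElement_def]; group
      have h2 := congrArg (· ^ orderOf x) h1
      simpa [conj_pow, hnx.inv_left.mul_pow, pow_orderOf_eq_one] using h2.symm
    have hnn : n = n⁻¹ := by
      rw [← hφN n hnN]
      calc n = (y ^ 2)⁻¹ * x⁻¹ * n * x * y ^ 2 := by
            rw [mul_assoc _ x⁻¹, hnx.inv_left.eq, ← mul_assoc, hny.inv_left.eq]; group
        _ = φ n := by
            rw [hn, commutatorElement_def]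
            simp only [map_mul, map_inv, map_pow, hφx, hφy]
            group
    have hn1 : n = 1 := by
      have h2 : n ^ 2 = 1 := by
        rw [pow_two]; nth_rewrite 1 [hnn]; exact inv_mul_cancel n
      have h := Nat.dvd_gcd (orderOf_dvd_of_pow_eq_one h2) (orderOf_dvd_of_pow_eq_one hnp)
      rw [(Nat.coprime_two_left.2 hx)] at h
      exact orderOf_eq_one_iff.1 (Nat.dvd_one.1 h)
    exact commutatorElement_eq_one_iff_commute.1 (hn ▸ hn1)

end Commutator

/-- In a finite group that is the product of the disjoint cyclic subgroups generated by `x` and `y`,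
where `x` has odd order, `(x * y) ^ 2 = 1`, and some endomorphism inverts both `x` and `y`,
the order of `y` is an even divisor of twice the order of `x`. -/
theorem even_orderOf_and_dvd_of_mul_zpow {G : Type*} [Group G] [Finite G] {x y : G}
    (hG : ∀ g : G, ∃ i j : ℤ, g = x ^ i * y ^ j) (φ : G →* G)
    (hφx : φ x = x⁻¹) (hφy : φ y = y⁻¹) (hxy : (x * y) ^ 2 = 1) (hx : Odd (orderOf x))
    (hx1 : x ≠ 1) (hdisj : ∀ i j : ℤ, x ^ i = y ^ j → x ^ i = 1) :
    Even (orderOf y) ∧ orderOf y ∣ 2 * orderOf x := by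
  have hc : Commute x (y ^ 2) := commute_sq_of_mul_zpow hG φ hφx hφy hxy hx
  constructor
  · by_contra hodd
    rw [Nat.not_even_iff_odd] at hodd
    obtain ⟨k, hk⟩ := hodd
    have hyk : y = (y ^ 2) ^ (k + 1) := by
      rw [← pow_mul, show 2 * (k + 1) = orderOf y + 1 by omega, pow_succ, pow_orderOf_eq_one,
        one_mul]
    have hcy : Commute x y := by rw [hyk]; exact hc.pow_right _
    rw [hcy.mul_pow] at hxy
    have h2 : x ^ (2 : ℤ) = y ^ (-2 : ℤ) := by
      rw [zpow_neg]; exact_mod_cast eq_inv_of_mul_eq_one_left hxy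
    have h3 : x ^ 2 = 1 := by exact_mod_cast hdisj _ _ h2
    have h := Nat.dvd_gcd (orderOf_dvd_of_pow_eq_one h3) dvd_rfl
    rw [Nat.coprime_two_left.2 hx] at h
    exact hx1 (orderOf_eq_one_iff.1 (Nat.dvd_one.1 h))
  · apply orderOf_dvd_of_pow_eq_one
    have h1 : y * x * y⁻¹ = x⁻¹ * (y ^ 2)⁻¹ := by
      have h : y * x * y⁻¹ = x⁻¹ * (x * y) ^ 2 * (y ^ 2)⁻¹ := by
        simp only [pow_two]; group
      rw [h, hxy, mul_one]
    have h2 := congrArg (· ^ orderOf x) h1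
    simp only [conj_pow, pow_orderOf_eq_one, mul_one, mul_inv_cancel,
      (hc.inv_left.inv_right).mul_pow, inv_pow, inv_one, one_mul] at h2
    rw [pow_mul]
    exact inv_eq_one.1 h2.symm

/-- If subgroups `A` and `B` meeting trivially are contained in `C`, then `|A| * |B| ≤ |C|`. -/
theorem card_mul_card_le_of_disjoint {G : Type*} [Group G] [Finite G] {A B C : Subgroup G}
    (hA : A ≤ C) (hB : B ≤ C) (h : A ⊓ B = ⊥) : Nat.card A * Nat.card B ≤ Nat.card C := by
  rw [← Nat.card_prod]
  exact Nat.card_le_card_of_injective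
    (fun t : A × B => (⟨t.1 * t.2, mul_mem (hA t.1.2) (hB t.2.2)⟩ : C))
    fun s t hst => Subgroup.mul_injective_of_disjoint (disjoint_iff.2 h) (congrArg Subtype.val hst)

/-- If subgroups `A` and `B` meeting trivially are contained in `C` and `|C| ≤ |A| * |B|`, then
`C = A * B`. -/
theorem exists_mul_eq_of_card_le {G : Type*} [Group G] [Finite G] {A B C : Subgroup G}
    (hA : A ≤ C) (hB : B ≤ C) (h : A ⊓ B = ⊥) (hcard : Nat.card C ≤ Nat.card A * Nat.card B)
    {g : G} (hg : g ∈ C) : ∃ a ∈ A, ∃ b ∈ B, g = a * b := by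
  rw [← Nat.card_prod] at hcard
  have hf : Function.Injective
      (fun t : A × B => (⟨t.1 * t.2, mul_mem (hA t.1.2) (hB t.2.2)⟩ : C)) :=
    fun s t hst => Subgroup.mul_injective_of_disjoint (disjoint_iff.2 h) (congrArg Subtype.val hst)
  obtain ⟨⟨a, b⟩, hab⟩ := (hf.bijective_of_nat_card_le hcard).2 ⟨g, hg⟩
  exact ⟨a, a.2, b, b.2, (congrArg Subtype.val hab).symm⟩

/-- Every element of the group generated by two involutions `a` and `b` is a power of `a * b`,
possibly followed by `b`. -/
theorem exists_zpow_of_mem_closure_pair {G : Type*} [Group G] {a b : G} (ha : a * a = 1)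
    (hb : b * b = 1) {g : G} (hg : g ∈ Subgroup.closure {a, b}) :
    ∃ i : ℤ, g = (a * b) ^ i ∨ g = (a * b) ^ i * b := by
  have hb' : b⁻¹ = b := inv_eq_of_mul_eq_one_left hb
  have ha' : a⁻¹ = a := inv_eq_of_mul_eq_one_left ha
  have hconj : ∀ i : ℤ, b * (a * b) ^ i = (a * b) ^ (-i) * b := fun i => by
    have h : b * (a * b) * b⁻¹ = (a * b)⁻¹ := by
      rw [mul_inv_rev, ha', hb', mul_assoc, mul_assoc, hb, mul_one]
    rw [zpow_neg, ← inv_zpow, ← h, conj_zpow, inv_mul_cancel_right]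
  induction hg using Subgroup.closure_induction with
  | mem g hg =>
    rcases hg with rfl | rfl
    · exact ⟨1, Or.inr (by rw [zpow_one, mul_assoc, hb, mul_one])⟩
    · exact ⟨0, Or.inr (by simp)⟩
  | one => exact ⟨0, Or.inl (by simp)⟩
  | mul g h _ _ hg hh =>
    obtain ⟨i, rfl | rfl⟩ := hg <;> obtain ⟨j, rfl | rfl⟩ := hh
    · exact ⟨i + j, Or.inl (zpow_add _ _ _).symm⟩
    · exact ⟨i + j, Or.inr (by rw [zpow_add, mul_assoc])⟩
    · exact ⟨i + -j, Or.inr (by rw [mul_assoc, hconj, zpow_add, mul_assoc])⟩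
    · exact ⟨i + -j, Or.inl (by
        rw [mul_assoc, ← mul_assoc b, hconj, mul_assoc _ b, hb, mul_one, zpow_add])⟩
  | inv g _ hg =>
    obtain ⟨i, rfl | rfl⟩ := hg
    · exact ⟨-i, Or.inl (zpow_neg _ _).symm⟩
    · exact ⟨i, Or.inr (by rw [mul_inv_rev, hb', ← zpow_neg, hconj, neg_neg])⟩

/-- The subgroup generated by the products of consecutive members of `ρ`. -/
def rotationSubgroup {G : Type*} [Group G] {n : ℕ} (ρ : Fin n → G) : Subgroup G :=
  Subgroup.closure {g : G | ∃ i j : Fin n, (i : ℕ) + 1 = (j : ℕ) ∧ g = ρ i * ρ j}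

section Rotation

variable {G : Type*} [Group G] {n : ℕ} {ρ : Fin n → G}

theorem mul_mem_rotationSubgroup {i j : Fin n} (h : (i : ℕ) + 1 = j) :
    ρ i * ρ j ∈ rotationSubgroup ρ :=
  Subgroup.subset_closure ⟨i, j, h, rfl⟩

theorem inv_mul_mem_rotationSubgroup (hinv : ∀ i, ρ i * ρ i = 1) (i j : Fin n) :
    (ρ i)⁻¹ * ρ j ∈ rotationSubgroup ρ := by
  have key : ∀ (d : ℕ) (i j : Fin n), (i : ℕ) + d = j → (ρ i)⁻¹ * ρ j ∈ rotationSubgroup ρ := by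
    intro d
    induction d with
    | zero => intro i j h; obtain rfl : i = j := Fin.ext h; simp
    | succ d ih =>
      intro i j h
      have h1 := ih i ⟨i + d, by omega⟩ rfl
      have h2 : ρ ⟨i + d, by omega⟩ * ρ j ∈ rotationSubgroup ρ :=
        mul_mem_rotationSubgroup (by simpa [add_assoc] using h)
      have h3 := mul_mem h1 h2
      rwa [mul_assoc, ← mul_assoc (ρ ⟨i + d, by omega⟩), hinv, one_mul] at h3
  rcases le_total (i : ℕ) j with h | h
  · exact key (j - i) i j (by omega)
  · have := inv_mem (key (i - j) j i (by omega))
    rwa [mul_inv_rev, inv_inv] at this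

theorem notMem_rotationSubgroup (hinv : ∀ i, ρ i * ρ i = 1)
    (hgen : Subgroup.closure (Set.range ρ) = ⊤) (hidx : (rotationSubgroup ρ).index = 2)
    (i : Fin n) : ρ i ∉ rotationSubgroup ρ := by
  intro hi
  have htop : rotationSubgroup ρ = ⊤ := by
    rw [eq_top_iff, ← hgen, Subgroup.closure_le]
    rintro _ ⟨j, rfl⟩
    have := mul_mem hi (inv_mul_mem_rotationSubgroup hinv i j)
    rwa [mul_inv_cancel_left] at this
  rw [htop, Subgroup.index_top] at hidx
  omega

theorem eq_one_of_mem_closure_of_mem_rotationSubgroup (hinv : ∀ i, ρ i * ρ i = 1)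
    (hgen : Subgroup.closure (Set.range ρ) = ⊤) (hidx : (rotationSubgroup ρ).index = 2)
    (hic : interCond ρ) {I J : Set (Fin n)} {b : Fin n} (hIJ : I ∩ J = {b}) {g : G}
    (hI : g ∈ Subgroup.closure (ρ '' I)) (hJ : g ∈ Subgroup.closure (ρ '' J))
    (hg : g ∈ rotationSubgroup ρ) : g = 1 := by
  have h : g ∈ Subgroup.closure (ρ '' (I ∩ J)) := hic I J ▸ ⟨hI, hJ⟩
  rw [hIJ, Set.image_singleton, ← Set.pair_eq_singleton] at h
  obtain ⟨i, h | h⟩ := exists_zpow_of_mem_closure_pair (hinv b) (hinv b) h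
  · rw [h, hinv, one_zpow]
  · rw [hinv, one_zpow, one_mul] at h
    exact absurd (h ▸ hg) (notMem_rotationSubgroup hinv hgen hidx b)

/-- The subgroup generated by `ρ_0, …, ρ_k`. -/
def initialSubgroup (ρ : Fin n → G) (k : ℕ) : Subgroup G :=
  Subgroup.closure (ρ '' {i | (i : ℕ) ≤ k})

theorem initialSubgroup_mono {k l : ℕ} (h : k ≤ l) :
    initialSubgroup ρ k ≤ initialSubgroup ρ l :=
  Subgroup.closure_mono (Set.image_mono fun i (hi : (i : ℕ) ≤ k) => hi.trans h)

theorem mem_initialSubgroup {k : ℕ} {i : Fin n} (h : (i : ℕ) ≤ k) : ρ i ∈ initialSubgroup ρ k :=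
  Subgroup.subset_closure ⟨i, h, rfl⟩

theorem zpowers_le_closure_pair (a b : Fin n) :
    Subgroup.zpowers (ρ a * ρ b) ≤ Subgroup.closure (ρ '' {a, b}) :=
  Subgroup.zpowers_le.2 (mul_mem (Subgroup.subset_closure ⟨a, by simp, rfl⟩)
    (Subgroup.subset_closure ⟨b, by simp, rfl⟩))

theorem zpowers_le_rotationSubgroup {a b : Fin n} (h : (a : ℕ) + 1 = b) :
    Subgroup.zpowers (ρ a * ρ b) ≤ rotationSubgroup ρ :=
  Subgroup.zpowers_le.2 (mul_mem_rotationSubgroup h)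

theorem zpowers_le_initialSubgroup {a b : Fin n} (h : (a : ℕ) + 1 = b) :
    Subgroup.zpowers (ρ a * ρ b) ≤ initialSubgroup ρ b :=
  Subgroup.zpowers_le.2 (mul_mem (mem_initialSubgroup (by omega)) (mem_initialSubgroup le_rfl))

theorem initialSubgroup_inf_zpowers (hinv : ∀ i, ρ i * ρ i = 1)
    (hgen : Subgroup.closure (Set.range ρ) = ⊤) (hidx : (rotationSubgroup ρ).index = 2)
    (hic : interCond ρ) {a b : Fin n} (h : (a : ℕ) + 1 = b) :
    initialSubgroup ρ a ⊓ Subgroup.zpowers (ρ a * ρ b) = ⊥ := by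
  rw [eq_bot_iff]
  rintro g ⟨hg1, hg2⟩
  refine eq_one_of_mem_closure_of_mem_rotationSubgroup hinv hgen hidx hic (b := a) ?_ hg1
    (zpowers_le_closure_pair a b hg2) (zpowers_le_rotationSubgroup h hg2)
  ext i
  simp only [Set.mem_inter_iff, Set.mem_ofPred_eq, Set.mem_insert_iff, Set.mem_singleton_iff,
    Fin.ext_iff]
  omega

/-- If the group has the least possible order, then so has every initial subgroup. -/
theorem card_initialSubgroup [Finite G] (hn : 1 ≤ n) (p : ℕ → ℕ)
    (hp : ∀ i : ℕ, 1 ≤ i → i ≤ n - 1 → 2 ≤ p i) (hinv : ∀ i, orderOf (ρ i) = 2)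
    (hle : ∀ k, k + 1 ≤ n - 1 →
      Nat.card (initialSubgroup ρ k) * p (k + 1) ≤ Nat.card (initialSubgroup ρ (k + 1)))
    (hcard : Nat.card G = 2 * ∏ i ∈ Finset.Icc 1 (n - 1), p i) {k : ℕ} (hk : k ≤ n - 1) :
    Nat.card (initialSubgroup ρ k) = 2 * ∏ i ∈ Finset.Icc 1 k, p i := by
  have lower : ∀ k, k ≤ n - 1 →
      2 * ∏ i ∈ Finset.Icc 1 k, p i ≤ Nat.card (initialSubgroup ρ k) := by
    intro k
    induction k with
    | zero =>
      intro _
      have h : Subgroup.zpowers (ρ ⟨0, hn⟩) ≤ initialSubgroup ρ 0 :=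
        Subgroup.zpowers_le.2 (mem_initialSubgroup le_rfl)
      simpa [Nat.card_zpowers, hinv] using Subgroup.card_le_of_le h
    | succ k ih =>
      intro hk
      rw [Finset.prod_Icc_succ_top (by omega), ← mul_assoc]
      exact (Nat.mul_le_mul_right _ (ih (by omega))).trans (hle k hk)
  refine le_antisymm ?_ (lower k hk)
  induction hk using Nat.decreasingInduction with
  | self => exact hcard ▸ Subgroup.card_le_card_group _
  | of_succ k hk ih =>
    rw [Finset.prod_Icc_succ_top (by omega), ← mul_assoc] at ih
    exact Nat.le_of_mul_le_mul_right ((hle k hk).trans ih) (by have := hp (k + 1); omega)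

/-- The arithmetic condition on two consecutive entries of the type. -/
theorem orderOf_dvd_of_tight (hinv : ∀ i, ρ i * ρ i = 1)
    (hgen : Subgroup.closure (Set.range ρ) = ⊤) (hidx : (rotationSubgroup ρ).index = 2)
    (hic : interCond ρ) [Finite G] {a b c : Fin n} (hab : (a : ℕ) + 1 = b) (hbc : (b : ℕ) + 1 = c)
    (hac : (ρ a * ρ c) ^ 2 = 1)
    (hcard : Nat.card (initialSubgroup ρ c) ≤
      Nat.card (initialSubgroup ρ b) * orderOf (ρ b * ρ c))
    (ha1 : ρ a * ρ b ≠ 1) (hb1 : ρ b * ρ c ≠ 1) :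
    (Odd (orderOf (ρ a * ρ b)) →
      Even (orderOf (ρ b * ρ c)) ∧ orderOf (ρ b * ρ c) ∣ 2 * orderOf (ρ a * ρ b)) ∧
    (Odd (orderOf (ρ b * ρ c)) →
      Even (orderOf (ρ a * ρ b)) ∧ orderOf (ρ a * ρ b) ∣ 2 * orderOf (ρ b * ρ c)) := by
  have hinv' : ∀ i, (ρ i)⁻¹ = ρ i := fun i => inv_eq_of_mul_eq_one_left (hinv i)
  set K : Subgroup G := Subgroup.closure {ρ a * ρ b, ρ b * ρ c} with hK
  have hKR : K ≤ rotationSubgroup ρ := by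
    rw [hK, Subgroup.closure_le]
    rintro _ (rfl | rfl)
    exacts [mul_mem_rotationSubgroup hab, mul_mem_rotationSubgroup hbc]
  have hKI : K ≤ Subgroup.closure (ρ '' {a, b, c}) := by
    have h : ∀ i ∈ ({a, b, c} : Set (Fin n)), ρ i ∈ Subgroup.closure (ρ '' {a, b, c}) :=
      fun i hi => Subgroup.subset_closure ⟨i, hi, rfl⟩
    rw [hK, Subgroup.closure_le]
    rintro _ (rfl | rfl)
    exacts [mul_mem (h a (by simp)) (h b (by simp)), mul_mem (h b (by simp)) (h c (by simp))]
  have hIc : Subgroup.closure (ρ '' {a, b, c}) ≤ initialSubgroup ρ c := by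
    refine Subgroup.closure_mono (Set.image_mono ?_)
    rintro i (rfl | rfl | rfl) <;> simp only [Set.mem_ofPred_eq] <;> omega
  let x : K := ⟨ρ a * ρ b, Subgroup.subset_closure (by simp)⟩
  let y : K := ⟨ρ b * ρ c, Subgroup.subset_closure (by simp)⟩
  have hprod : ∀ g : K, ∃ i j : ℤ, g = x ^ i * y ^ j := by
    rintro ⟨g, hg⟩
    rw [← Nat.card_zpowers] at hcard
    obtain ⟨h, hh, _, ⟨j, rfl⟩, hgj⟩ := exists_mul_eq_of_card_le
      (initialSubgroup_mono (by omega)) (zpowers_le_initialSubgroup hbc)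
      (initialSubgroup_inf_zpowers hinv hgen hidx hic hbc) hcard (hIc (hKI hg))
    replace hgj : g = h * (ρ b * ρ c) ^ j := hgj
    have hhK : h ∈ K := by
      rw [eq_mul_inv_of_mul_eq hgj.symm]
      exact mul_mem hg (inv_mem (zpow_mem y.2 j))
    have hhab : h ∈ Subgroup.closure {ρ a, ρ b} := by
      have hmem : h ∈ Subgroup.closure (ρ '' ({i | (i : ℕ) ≤ b} ∩ {a, b, c})) :=
        hic _ _ ▸ ⟨hh, hKI hhK⟩
      rw [← Set.image_pair]
      refine Subgroup.closure_mono (Set.image_mono ?_) hmem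
      intro i
      simp only [Set.mem_inter_iff, Set.mem_ofPred_eq, Set.mem_insert_iff, Set.mem_singleton_iff,
        Fin.ext_iff]
      omega
    obtain ⟨i, rfl | rfl⟩ := exists_zpow_of_mem_closure_pair (hinv a) (hinv b) hhab
    · exact ⟨i, j, Subtype.ext hgj⟩
    · have := (Subgroup.mul_mem_cancel_left _ (zpow_mem (mul_mem_rotationSubgroup hab) i)).1
        (hKR hhK)
      exact absurd this (notMem_rotationSubgroup hinv hgen hidx b)
  have hcx : ρ b * (ρ a * ρ b) * (ρ b)⁻¹ = (ρ a * ρ b)⁻¹ := by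
    rw [mul_inv_rev, hinv' a, mul_assoc, mul_inv_cancel_right, hinv']
  have hcy : ρ b * (ρ b * ρ c) * (ρ b)⁻¹ = (ρ b * ρ c)⁻¹ := by
    rw [← mul_assoc, hinv, one_mul, mul_inv_rev, hinv' c]
  have hconj : K ≤ K.comap (MulAut.conj (ρ b)).toMonoidHom := by
    nth_rewrite 1 [hK]
    rw [Subgroup.closure_le]
    rintro _ (rfl | rfl)
    · change ρ b * (ρ a * ρ b) * (ρ b)⁻¹ ∈ K
      rw [hcx]; exact inv_mem x.2
    · change ρ b * (ρ b * ρ c) * (ρ b)⁻¹ ∈ K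
      rw [hcy]; exact inv_mem y.2
  let φ : K →* K := ((MulAut.conj (ρ b)).toMonoidHom.comp K.subtype).codRestrict K
    fun k => hconj k.2
  have hφx : φ x = x⁻¹ := Subtype.ext hcx
  have hφy : φ y = y⁻¹ := Subtype.ext hcy
  have hxy : (x * y) ^ 2 = 1 := by
    apply Subtype.ext
    change (ρ a * ρ b * (ρ b * ρ c)) ^ 2 = 1
    rw [mul_assoc, ← mul_assoc (ρ b), hinv, one_mul, hac]
  have hdisj : ∀ i j : ℤ, x ^ i = y ^ j → x ^ i = 1 := by
    intro i j hij
    apply Subtype.ext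
    have hij' : (ρ a * ρ b) ^ i = (ρ b * ρ c) ^ j := congrArg Subtype.val hij
    change (ρ a * ρ b) ^ i = 1
    refine eq_one_of_mem_closure_of_mem_rotationSubgroup hinv hgen hidx hic
      (I := {a, b}) (J := {b, c}) (b := b) ?_
      (zpowers_le_closure_pair a b ⟨i, rfl⟩)
      (hij' ▸ zpowers_le_closure_pair b c ⟨j, rfl⟩)
      (zpowers_le_rotationSubgroup hab ⟨i, rfl⟩)
    ext i
    simp only [Set.mem_inter_iff, Set.mem_insert_iff, Set.mem_singleton_iff, Fin.ext_iff]
    omega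
  have hox : orderOf x = orderOf (ρ a * ρ b) := (Subgroup.orderOf_coe x).symm
  have hoy : orderOf y = orderOf (ρ b * ρ c) := (Subgroup.orderOf_coe y).symm
  rw [← hox, ← hoy]
  refine ⟨fun hodd => even_orderOf_and_dvd_of_mul_zpow hprod φ hφx hφy hxy hodd
    (fun h => ha1 (congrArg Subtype.val h)) hdisj, fun hodd => ?_⟩
  have hprod' : ∀ g : K, ∃ i j : ℤ, g = (y⁻¹) ^ i * (x⁻¹) ^ j := fun g => by
    obtain ⟨i, j, h⟩ := hprod g⁻¹
    exact ⟨j, i, by rw [← inv_inv g, h]; group⟩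
  have hxy' : (y⁻¹ * x⁻¹) ^ 2 = 1 := by rw [← mul_inv_rev, inv_pow, hxy, inv_one]
  have hdisj' : ∀ i j : ℤ, (y⁻¹) ^ i = (x⁻¹) ^ j → (y⁻¹) ^ i = 1 := fun i j h => by
    rw [h]
    rw [inv_zpow', inv_zpow'] at h
    rw [inv_zpow']
    exact hdisj _ _ h.symm
  have h := even_orderOf_and_dvd_of_mul_zpow hprod' φ (by rw [map_inv, hφy]) (by rw [map_inv, hφx])
    hxy' (by rwa [orderOf_inv]) (fun h => hb1 (congrArg Subtype.val (inv_eq_one.1 h))) hdisj'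
  rwa [orderOf_inv, orderOf_inv] at h

end Rotation

/-- If `Γ` is a finite group generated by `n` involutions `ρ_0, …, ρ_{n-1}` with
`(ρ_i ρ_j)² = 1` for `|i - j| ≥ 2`, satisfying the intersection condition, with
`ρ_{i-1} ρ_i` of order `p_i`, `|Γ| = 2 p_1 ⋯ p_{n-1}`, and rotation subgroup of index 2
(i.e. `Γ` is the automorphism group of a tight orientably-regular `n`-polytope of type
`{p_1, …, p_{n-1}}`), then the tuple `(p_1, …, p_{n-1})` is admissible. -/
theorem admissible_of_tight_orientably_regular
    (n : ℕ) (hn : 3 ≤ n) (p : ℕ → ℕ) (hp : ∀ i : ℕ, 1 ≤ i → i ≤ n - 1 → 2 ≤ p i)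
    (G : Type*) [Group G] [Finite G] (ρ : Fin n → G)
    (hinv : ∀ i, orderOf (ρ i) = 2)
    (hgen : Subgroup.closure (Set.range ρ) = ⊤)
    (hcomm : ∀ i j : Fin n, (i : ℕ) + 2 ≤ (j : ℕ) → (ρ i * ρ j) ^ 2 = 1)
    (hic : interCond ρ)
    (hord : ∀ i j : Fin n, (i : ℕ) + 1 = (j : ℕ) → orderOf (ρ i * ρ j) = p (j : ℕ))
    (hcard : Nat.card G = 2 * ∏ i ∈ Finset.Icc 1 (n - 1), p i)
    (hidx : (Subgroup.closure
      {g : G | ∃ i j : Fin n, (i : ℕ) + 1 = (j : ℕ) ∧ g = ρ i * ρ j}).index = 2) :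
    Admissible n p := by
  have hinv' : ∀ i, ρ i * ρ i = 1 := fun i => by rw [← pow_two, ← hinv i, pow_orderOf_eq_one]
  have hidx' : (rotationSubgroup ρ).index = 2 := hidx
  have hle : ∀ k, k + 1 ≤ n - 1 →
      Nat.card (initialSubgroup ρ k) * p (k + 1) ≤ Nat.card (initialSubgroup ρ (k + 1)) := by
    intro k hk
    obtain ⟨a, ha⟩ : ∃ a : Fin n, (a : ℕ) = k := ⟨⟨k, by omega⟩, rfl⟩
    obtain ⟨b, hb⟩ : ∃ b : Fin n, (b : ℕ) = k + 1 := ⟨⟨k + 1, by omega⟩, rfl⟩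
    have hab : (a : ℕ) + 1 = b := by omega
    rw [← hb, ← ha, ← hord a b hab, ← Nat.card_zpowers]
    exact card_mul_card_le_of_disjoint (initialSubgroup_mono (by omega))
      (zpowers_le_initialSubgroup hab) (initialSubgroup_inf_zpowers hinv' hgen hidx' hic hab)
  have key : ∀ k, 1 ≤ k → k + 1 ≤ n - 1 →
      (Odd (p k) → Even (p (k + 1)) ∧ p (k + 1) ∣ 2 * p k) ∧
      (Odd (p (k + 1)) → Even (p k) ∧ p k ∣ 2 * p (k + 1)) := by
    intro k hk1 hk2
    obtain ⟨a, ha⟩ : ∃ a : Fin n, (a : ℕ) = k - 1 := ⟨⟨k - 1, by omega⟩, rfl⟩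
    obtain ⟨b, hb⟩ : ∃ b : Fin n, (b : ℕ) = k := ⟨⟨k, by omega⟩, rfl⟩
    obtain ⟨c, hc⟩ : ∃ c : Fin n, (c : ℕ) = k + 1 := ⟨⟨k + 1, by omega⟩, rfl⟩
    have hab : (a : ℕ) + 1 = b := by omega
    have hbc : (b : ℕ) + 1 = c := by omega
    have hoab : orderOf (ρ a * ρ b) = p k := by rw [hord a b hab, hb]
    have hobc : orderOf (ρ b * ρ c) = p (k + 1) := by rw [hord b c hbc, hc]
    have hpk := hp k hk1 (by omega)
    have hpk' := hp (k + 1) (by omega) hk2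
    have hcard' : Nat.card (initialSubgroup ρ c) ≤
        Nat.card (initialSubgroup ρ b) * orderOf (ρ b * ρ c) := by
      rw [hobc, hb, hc, card_initialSubgroup (by omega) p hp hinv hle hcard hk2,
        card_initialSubgroup (by omega) p hp hinv hle hcard (k := k) (by omega),
        Finset.prod_Icc_succ_top (by omega), mul_assoc]
    have h := orderOf_dvd_of_tight hinv' hgen hidx' hic hab hbc (hcomm a c (by omega)) hcard'
      (fun h1 => by rw [h1, orderOf_one] at hoab; omega)
      (fun h1 => by rw [h1, orderOf_one] at hobc; omega)
    rwa [hoab, hobc] at h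
  intro i hi1 hi2 hodd
  refine ⟨fun h => ?_, fun h => (key i hi1 h).1 hodd⟩
  obtain ⟨k, rfl⟩ : ∃ k, i = k + 1 := ⟨i - 1, by omega⟩
  exact (key k (by omega) hi2).2 hodd
end

section
/- Let n ≥ 3 and let p_1, …, p_{n−1} be integers, each at least 2. Fix i with 1 ≤ i ≤ n−1 and suppose p_i is even, and set ω = (x_{i−1} x_i)² in Γ(p_1, …, p_{n−1}). Then every element g of Γ(p_1, …, p_{n−1}) satisfies g ω g⁻¹ = ω or g ω g⁻¹ = ω⁻¹. In particular, the square of every element of Γ(p_1, …, p_{n−1}) commutes with ω. -/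
/-- The defining relations of the group `Γ(p_1, …, p_{n-1})`: the generators `x_0, …, x_{n-1}`
are involutions, `(x_{i-1} x_i)^{p_i} = 1`, `(x_i x_j)^2 = 1` for `|i - j| ≥ 2`, together with
the extra relators `r_i` (depending on the parities of `p_i` and `p_{i+1}`). -/
def gammaRels (n : ℕ) (p : ℕ → ℕ) : Set (FreeGroup (Fin n)) :=
  {w | (∃ i : Fin n, w = (FreeGroup.of i) ^ 2)
     ∨ (∃ i j : Fin n, (i : ℕ) + 1 = (j : ℕ) ∧
          w = (FreeGroup.of i * FreeGroup.of j) ^ (p (j : ℕ)))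
     ∨ (∃ i j : Fin n, (i : ℕ) + 2 ≤ (j : ℕ) ∧
          w = (FreeGroup.of i * FreeGroup.of j) ^ 2)
     ∨ (∃ a b c : Fin n, (a : ℕ) + 1 = (b : ℕ) ∧ (b : ℕ) + 1 = (c : ℕ) ∧
         ((Even (p (b : ℕ)) ∧ Even (p (c : ℕ)) ∧
             w = (FreeGroup.of a * FreeGroup.of b * FreeGroup.of c * FreeGroup.of b) ^ 2)
        ∨ (Odd (p (b : ℕ)) ∧ Even (p (c : ℕ)) ∧
             w = (FreeGroup.of a * FreeGroup.of b * FreeGroup.of c * FreeGroup.of b *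
                  FreeGroup.of c) ^ 2)
        ∨ (Even (p (b : ℕ)) ∧ Odd (p (c : ℕ)) ∧
             w = (FreeGroup.of c * FreeGroup.of b * FreeGroup.of a * FreeGroup.of b *
                  FreeGroup.of a) ^ 2)))}

/-- The group `Γ(p_1, …, p_{n-1})`. -/
abbrev Gamma (n : ℕ) (p : ℕ → ℕ) : Type := PresentedGroup (gammaRels n p)

/-- The generator `x_i` of `Γ(p_1, …, p_{n-1})`. -/
def xg (n : ℕ) (p : ℕ → ℕ) (i : Fin n) : Gamma n p := PresentedGroup.of i

section Involutions

variable {G : Type*} [Group G] {a b c w : G}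

theorem inv_eq_self_of_sq_eq_one (ha : a ^ 2 = 1) : a⁻¹ = a :=
  inv_eq_of_mul_eq_one_left (by rw [← sq, ha])

theorem sq_mul_inv_of_involutions (ha : a ^ 2 = 1) (hb : b ^ 2 = 1) :
    ((a * b) ^ 2)⁻¹ = (b * a) ^ 2 := by
  rw [← inv_pow, mul_inv_rev, inv_eq_self_of_sq_eq_one ha, inv_eq_self_of_sq_eq_one hb]

theorem commute_of_sq_mul_eq_one (ha : a ^ 2 = 1) (hb : b ^ 2 = 1) (hab : (a * b) ^ 2 = 1) :
    Commute a b := by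
  have h := inv_eq_self_of_sq_eq_one hab
  rw [mul_inv_rev, inv_eq_self_of_sq_eq_one ha, inv_eq_self_of_sq_eq_one hb] at h
  exact h.symm

theorem conj_eq_inv_of_sq_mul_eq_one (hc : c ^ 2 = 1) (hcw : (c * w) ^ 2 = 1) :
    c * w * c⁻¹ = w⁻¹ := by
  rw [inv_eq_self_of_sq_eq_one hc]
  exact eq_inv_of_mul_eq_one_left (by rw [← hcw, sq, mul_assoc _ c w])

theorem conj_right_sq_mul (ha : a ^ 2 = 1) (hb : b ^ 2 = 1) :
    b * (a * b) ^ 2 * b⁻¹ = ((a * b) ^ 2)⁻¹ := by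
  rw [sq_mul_inv_of_involutions ha hb, sq, sq]
  group

theorem conj_left_sq_mul (ha : a ^ 2 = 1) (hb : b ^ 2 = 1) :
    a * (a * b) ^ 2 * a⁻¹ = ((a * b) ^ 2)⁻¹ := by
  rw [← sq_mul_inv_of_involutions hb ha, ← conj_inv, conj_right_sq_mul hb ha]

/-- If `a` commutes with `c` and with `b c b`, where `b` is an involution, then `a` commutes
with `(b c)²`. -/
theorem commute_sq_mul (ha : a ^ 2 = 1) (hb : b ^ 2 = 1) (hc : c ^ 2 = 1)
    (hac : Commute a c) (h : (a * b * c * b) ^ 2 = 1) : Commute a ((b * c) ^ 2) := by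
  have hd : (b * c * b) ^ 2 = 1 := by
    have := conj_pow (a := b) (b := c) (i := 2)
    rw [hc, inv_eq_self_of_sq_eq_one hb, mul_one, ← sq, hb] at this
    exact this
  have := (commute_of_sq_mul_eq_one ha hd (by simpa only [mul_assoc] using h)).mul_right hac
  rwa [show (b * c) ^ 2 = b * c * b * c by rw [sq, ← mul_assoc]]

theorem conj_eq_self_or_inv_iff_inv {g : G} :
    (g * w⁻¹ * g⁻¹ = w⁻¹ ∨ g * w⁻¹ * g⁻¹ = w⁻¹⁻¹) ↔ (g * w * g⁻¹ = w ∨ g * w * g⁻¹ = w⁻¹) := by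
  simp only [← conj_inv, inv_inj]

/-- The subgroup of elements conjugating `w` to `w` or to `w⁻¹`. -/
def conjSelfOrInv (w : G) : Subgroup G where
  carrier := {g | g * w * g⁻¹ = w ∨ g * w * g⁻¹ = w⁻¹}
  one_mem' := by simp
  mul_mem' := by
    intro g h hg hh
    have key : g * h * w * (g * h)⁻¹ = g * (h * w * h⁻¹) * g⁻¹ := by group
    simp only [Set.mem_ofPred_eq] at hg hh ⊢
    rw [key]
    rcases hh with hh | hh
    · rwa [hh]
    · rw [hh, ← conj_inv, inv_inj, inv_eq_iff_eq_inv]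
      exact hg.symm
  inv_mem' := by
    intro g hg
    have aux : ∀ v : G, g * w * g⁻¹ = v → g⁻¹ * v * g⁻¹⁻¹ = w := by
      rintro _ rfl
      group
    rcases hg with hg | hg
    · exact Or.inl (aux _ hg)
    · right
      rw [← inv_eq_iff_eq_inv, conj_inv]
      exact aux _ hg

theorem mem_conjSelfOrInv_of_commute {g : G} (h : Commute g w) : g ∈ conjSelfOrInv w :=
  Or.inl (mul_inv_eq_of_eq_mul h)

theorem conjSelfOrInv_inv (w : G) : conjSelfOrInv w⁻¹ = conjSelfOrInv w :=
  Subgroup.ext fun _ => conj_eq_self_or_inv_iff_inv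

theorem commute_sq_of_mem_conjSelfOrInv {g : G} (hg : g ∈ conjSelfOrInv w) :
    Commute (g ^ 2) w := by
  have key : g ^ 2 * w * (g ^ 2)⁻¹ = g * (g * w * g⁻¹) * g⁻¹ := by
    rw [sq]
    group
  refine mul_inv_eq_iff_eq_mul.mp ?_
  rw [key]
  rcases hg with hg | hg
  · rw [hg, hg]
  · rw [hg, ← conj_inv, hg, inv_inv]

end Involutions

section Relations

variable {n : ℕ} {p : ℕ → ℕ}

theorem xg_sq (i : Fin n) : xg n p i ^ 2 = 1 :=
  PresentedGroup.one_of_mem (rels := gammaRels n p) (Or.inl ⟨i, rfl⟩)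

theorem commute_xg {i j : Fin n} (h : (i : ℕ) + 2 ≤ j) : Commute (xg n p i) (xg n p j) :=
  commute_of_sq_mul_eq_one (xg_sq i) (xg_sq j)
    (PresentedGroup.one_of_mem (rels := gammaRels n p) (Or.inr (Or.inr (Or.inl ⟨i, j, h, rfl⟩))))

variable {a b c : Fin n}

theorem xg_rel_even_even (hab : (a : ℕ) + 1 = b) (hbc : (b : ℕ) + 1 = c)
    (hb : Even (p b)) (hc : Even (p c)) :
    (xg n p a * xg n p b * xg n p c * xg n p b) ^ 2 = 1 :=
  PresentedGroup.one_of_mem (rels := gammaRels n p)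
    (Or.inr (Or.inr (Or.inr ⟨a, b, c, hab, hbc, Or.inl ⟨hb, hc, rfl⟩⟩)))

theorem xg_rel_odd_even (hab : (a : ℕ) + 1 = b) (hbc : (b : ℕ) + 1 = c)
    (hb : Odd (p b)) (hc : Even (p c)) :
    (xg n p a * xg n p b * xg n p c * xg n p b * xg n p c) ^ 2 = 1 :=
  PresentedGroup.one_of_mem (rels := gammaRels n p)
    (Or.inr (Or.inr (Or.inr ⟨a, b, c, hab, hbc, Or.inr (Or.inl ⟨hb, hc, rfl⟩)⟩)))

theorem xg_rel_even_odd (hab : (a : ℕ) + 1 = b) (hbc : (b : ℕ) + 1 = c)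
    (hb : Even (p b)) (hc : Odd (p c)) :
    (xg n p c * xg n p b * xg n p a * xg n p b * xg n p a) ^ 2 = 1 :=
  PresentedGroup.one_of_mem (rels := gammaRels n p)
    (Or.inr (Or.inr (Or.inr ⟨a, b, c, hab, hbc, Or.inr (Or.inr ⟨hb, hc, rfl⟩)⟩)))

theorem xg_left_mem_conjSelfOrInv (hab : (a : ℕ) + 1 = b) (hbc : (b : ℕ) + 1 = c)
    (hc : Even (p c)) :
    xg n p a ∈ conjSelfOrInv ((xg n p b * xg n p c) ^ 2) := by
  rcases Nat.even_or_odd (p b) with hb | hb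
  · exact mem_conjSelfOrInv_of_commute (commute_sq_mul (xg_sq a) (xg_sq b) (xg_sq c)
      (commute_xg (by omega)) (xg_rel_even_even hab hbc hb hc))
  · refine Or.inr (conj_eq_inv_of_sq_mul_eq_one (xg_sq a) ?_)
    simpa only [sq (xg n p b * xg n p c), mul_assoc] using xg_rel_odd_even hab hbc hb hc

theorem xg_right_mem_conjSelfOrInv (hab : (a : ℕ) + 1 = b) (hbc : (b : ℕ) + 1 = c)
    (hb : Even (p b)) :
    xg n p c ∈ conjSelfOrInv ((xg n p a * xg n p b) ^ 2) := by
  rw [← conjSelfOrInv_inv, sq_mul_inv_of_involutions (xg_sq a) (xg_sq b)]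
  rcases Nat.even_or_odd (p c) with hc | hc
  · refine mem_conjSelfOrInv_of_commute (commute_sq_mul (xg_sq c) (xg_sq b) (xg_sq a)
      (commute_xg (by omega)).symm ?_)
    have h := inv_eq_one.mpr (xg_rel_even_even hab hbc hb hc)
    simp only [← inv_pow, mul_inv_rev, inv_eq_self_of_sq_eq_one (xg_sq _), ← mul_assoc] at h
    calc (xg n p c * xg n p b * xg n p a * xg n p b) ^ 2
        = (xg n p b)⁻¹ * (xg n p b * xg n p c * xg n p b * xg n p a) ^ 2 * xg n p b := by
          rw [sq, sq]
          group
      _ = 1 := by rw [h, mul_one, inv_mul_cancel]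
  · refine Or.inr (conj_eq_inv_of_sq_mul_eq_one (xg_sq c) ?_)
    simpa only [sq (xg n p b * xg n p a), mul_assoc] using xg_rel_even_odd hab hbc hb hc

end Relations

theorem xg_mem_conjSelfOrInv {n : ℕ} {p : ℕ → ℕ} {i j : Fin n} (hij : (i : ℕ) + 1 = j)
    (hpe : Even (p j)) (k : Fin n) :
    xg n p k ∈ conjSelfOrInv ((xg n p i * xg n p j) ^ 2) := by
  have hk : (k : ℕ) + 2 ≤ i ∨ (k : ℕ) + 1 = i ∨ k = i ∨ k = j ∨ (j : ℕ) + 1 = k ∨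
      (j : ℕ) + 2 ≤ k := by
    simp only [Fin.ext_iff]
    omega
  rcases hk with hk | hk | rfl | rfl | hk | hk
  · exact mem_conjSelfOrInv_of_commute
      (((commute_xg hk).mul_right (commute_xg (by omega))).pow_right 2)
  · exact xg_left_mem_conjSelfOrInv hk hij hpe
  · exact Or.inr (conj_left_sq_mul (xg_sq _) (xg_sq _))
  · exact Or.inr (conj_right_sq_mul (xg_sq _) (xg_sq _))
  · exact xg_right_mem_conjSelfOrInv hij hk hpe
  · exact mem_conjSelfOrInv_of_commute
      (((commute_xg (by omega)).symm.mul_right (commute_xg hk).symm).pow_right 2)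

/-- Suppose `p_i` is even (where `x_{i-1}, x_i` are consecutive generators of
`Γ(p_1, …, p_{n-1})`), and let `ω = (x_{i-1} x_i)²`. Then every element of
`Γ(p_1, …, p_{n-1})` conjugates `ω` to `ω` or to `ω⁻¹`; in particular the square of every
element commutes with `ω`. -/
theorem conj_even_omega (n : ℕ) (hn : 3 ≤ n) (p : ℕ → ℕ)
    (hp : ∀ k : ℕ, 1 ≤ k → k ≤ n - 1 → 2 ≤ p k)
    (i j : Fin n) (hij : (i : ℕ) + 1 = (j : ℕ)) (hpe : Even (p (j : ℕ))) :
    (∀ g : Gamma n p,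
        g * (xg n p i * xg n p j) ^ 2 * g⁻¹ = (xg n p i * xg n p j) ^ 2 ∨
        g * (xg n p i * xg n p j) ^ 2 * g⁻¹ = ((xg n p i * xg n p j) ^ 2)⁻¹) ∧
    (∀ g : Gamma n p,
        g ^ 2 * (xg n p i * xg n p j) ^ 2 = (xg n p i * xg n p j) ^ 2 * g ^ 2) := by
  have hmem : ∀ g : Gamma n p, g ∈ conjSelfOrInv ((xg n p i * xg n p j) ^ 2) := by
    have htop : (⊤ : Subgroup (Gamma n p)) ≤ conjSelfOrInv ((xg n p i * xg n p j) ^ 2) := by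
      rw [← PresentedGroup.closure_range_of, Subgroup.closure_le]
      rintro _ ⟨k, rfl⟩
      exact xg_mem_conjSelfOrInv hij hpe k
    exact fun g => htop (Subgroup.mem_top g)
  exact ⟨hmem, fun g => commute_sq_of_mem_conjSelfOrInv (hmem g)⟩
end

section
/- Let n ≥ 3 and let (p_1, …, p_{n−1}) be an admissible tuple of integers, each at least 2, with the property that for every i strictly between 1 and n−1, either p_i = 2 or p_{i−1} = p_{i+1} = 2. Then in Γ(p_1, …, p_{n−1}), the element x_{i−1} x_i has order exactly p_i for each 1 ≤ i ≤ n−1, and the order of Γ(p_1, …, p_{n−1}) equals 2 p_1 p_2 ⋯ p_{n−1}. -/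
open Pointwise in
/-- If `A * B` is closed under right multiplication by the involutions in `T`, then it bounds the
subgroup generated by `T`. -/
theorem card_closure_le_of_mul_mem {G : Type*} [Group G] {T A B : Set G}
    (hA : A.Finite) (hB : B.Finite) (hA1 : (1 : G) ∈ A) (hB1 : (1 : G) ∈ B)
    (hT : ∀ t ∈ T, t * t = 1) (h : ∀ a ∈ A, ∀ b ∈ B, ∀ t ∈ T, a * b * t ∈ A * B) :
    Finite (Subgroup.closure T) ∧ Nat.card (Subgroup.closure T) ≤ Nat.card A * Nat.card B := by
  have hsub : (Subgroup.closure T : Set G) ⊆ A * B := by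
    intro g hg
    refine Subgroup.closure_induction_right (p := fun g _ => g ∈ A * B)
      ⟨1, hA1, 1, hB1, mul_one 1⟩ ?_ ?_ hg
    · rintro _ - t ht ⟨a, ha, b, hb, rfl⟩
      exact h a ha b hb t ht
    · rintro _ - t ht ⟨a, ha, b, hb, rfl⟩
      rw [inv_eq_of_mul_eq_one_left (hT t ht)]
      exact h a ha b hb t ht
  exact ⟨((hA.mul hB).subset hsub).to_subtype,
    (Nat.card_mono (hA.mul hB) hsub).trans Set.natCard_mul_le⟩

theorem card_closure_union_le {G : Type*} [Group G] {S T : Set G}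
    [Finite (Subgroup.closure S)] [Finite (Subgroup.closure T)]
    (hS : ∀ s ∈ S, s * s = 1) (hT : ∀ t ∈ T, t * t = 1) (hST : ∀ s ∈ S, ∀ t ∈ T, Commute s t) :
    Finite (Subgroup.closure (S ∪ T)) ∧ Nat.card (Subgroup.closure (S ∪ T)) ≤
      Nat.card (Subgroup.closure S) * Nat.card (Subgroup.closure T) := by
  refine card_closure_le_of_mul_mem (A := (Subgroup.closure S : Set G))
    (B := (Subgroup.closure T : Set G)) (Set.toFinite _) (Set.toFinite _)
    (one_mem (Subgroup.closure S)) (one_mem (Subgroup.closure T)) ?_ ?_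
  · rintro t (ht | ht)
    exacts [hS t ht, hT t ht]
  · rintro a ha b hb t (ht | ht)
    · have hle : Subgroup.closure T ≤ Subgroup.centralizer {t} := by
        rw [Subgroup.closure_le]
        intro u hu
        rw [SetLike.mem_coe, Subgroup.mem_centralizer_singleton_iff]
        exact (hST t ht u hu).eq.symm
      have hbt := Subgroup.mem_centralizer_singleton_iff.1 (hle hb)
      refine ⟨a * t, mul_mem ha (Subgroup.subset_closure ht), b, hb, ?_⟩
      simp only [mul_assoc, hbt]
    · exact ⟨a, ha, b * t, mul_mem hb (Subgroup.subset_closure ht), (mul_assoc _ _ _).symm⟩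

theorem semiconjBy_mul_inv_of_involutions {G : Type*} [Group G] {b c : G} (hb : b * b = 1)
    (hc : c * c = 1) : SemiconjBy b (b * c) (b * c)⁻¹ ∧ SemiconjBy c (b * c) (b * c)⁻¹ := by
  have hb' : b⁻¹ = b := inv_eq_of_mul_eq_one_left hb
  have hc' : c⁻¹ = c := inv_eq_of_mul_eq_one_left hc
  constructor
  · simp only [SemiconjBy, mul_inv_rev, hb', hc', mul_assoc, hb, mul_one]
    rw [← mul_assoc, hb, one_mul]
  · simp only [SemiconjBy, mul_inv_rev, hb', hc', mul_assoc]

theorem zpow_mul_eq_of_semiconjBy_inv {G : Type*} [Group G] {x s : G} (h : SemiconjBy x s s⁻¹)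
    (k : ℤ) : s ^ k * x = x * s ^ (-k) := by
  have := (h.zpow_right (-k)).eq
  rw [this, inv_zpow, zpow_neg, inv_inv]

open Pointwise in
/-- The subgroup generated by `T` lies in `H⟨bc⟩` once every element of `T` other than the
involutions `b ∈ H` and `c` moves `⟨bc⟩` into `H⟨bc⟩`. -/
theorem card_closure_le_of_zpowers {G : Type*} [Group G] {H : Subgroup G} [Finite H] {b c : G}
    {q : ℕ} {T : Set G} (hbH : b ∈ H) (hb : b * b = 1) (hc : c * c = 1) (hq : 0 < q)
    (hbc : (b * c) ^ q = 1) (hT : ∀ t ∈ T, t * t = 1)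
    (h : ∀ t ∈ T, t = b ∨ t = c ∨
      ∀ k : ℤ, (b * c) ^ k * t ∈ (H : Set G) * (Subgroup.zpowers (b * c) : Set G)) :
    Finite (Subgroup.closure T) ∧ Nat.card (Subgroup.closure T) ≤ Nat.card H * q := by
  have hfin : Finite (Subgroup.zpowers (b * c)) :=
    finite_zpowers.2 (isOfFinOrder_iff_pow_eq_one.2 ⟨q, hq, hbc⟩)
  have hcard : Nat.card (Subgroup.zpowers (b * c)) ≤ q := by
    rw [Nat.card_zpowers]
    exact orderOf_le_of_pow_eq_one hq hbc
  obtain ⟨hb1, hc1⟩ := semiconjBy_mul_inv_of_involutions hb hc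
  have key := card_closure_le_of_mul_mem (T := T) (A := H) (B := Subgroup.zpowers (b * c))
    (Set.toFinite _) (Set.toFinite _) (one_mem H) (one_mem (Subgroup.zpowers (b * c))) hT ?_
  · exact ⟨key.1, key.2.trans (Nat.mul_le_mul_left _ hcard)⟩
  rintro a ha _ ⟨k, rfl⟩ t ht
  have hmem : (b * c) ^ k * t ∈ (H : Set G) * (Subgroup.zpowers (b * c) : Set G) := by
    rcases h t ht with rfl | rfl | h
    · exact ⟨t, hbH, _, ⟨-k, rfl⟩, (zpow_mul_eq_of_semiconjBy_inv hb1 k).symm⟩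
    · refine ⟨b, hbH, _, ⟨1 + -k, rfl⟩, ?_⟩
      simp only [zpow_add, zpow_one]
      rw [zpow_mul_eq_of_semiconjBy_inv hc1 k, ← mul_assoc, ← mul_assoc, hb, one_mul]
    · exact h k
  obtain ⟨u, hu, v, hv, huv⟩ := hmem
  refine ⟨a * u, mul_mem ha hu, v, hv, ?_⟩
  simp only at huv ⊢
  rw [mul_assoc, huv, mul_assoc]

theorem card_closure_singleton_le {G : Type*} [Group G] {a : G} (ha : a * a = 1) :
    Finite (Subgroup.closure {a}) ∧ Nat.card (Subgroup.closure {a}) ≤ 2 := by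
  have ha2 : a ^ 2 = 1 := by rw [pow_two, ha]
  rw [← Subgroup.zpowers_eq_closure]
  refine ⟨finite_zpowers.2 (isOfFinOrder_iff_pow_eq_one.2 ⟨2, two_pos, ha2⟩), ?_⟩
  rw [Nat.card_zpowers]
  exact orderOf_le_of_pow_eq_one two_pos ha2

theorem card_closure_pair_le {G : Type*} [Group G] {a b : G} {p : ℕ} (ha : a * a = 1)
    (hb : b * b = 1) (hp : 0 < p) (hab : (a * b) ^ p = 1) :
    Finite (Subgroup.closure {a, b}) ∧ Nat.card (Subgroup.closure {a, b}) ≤ 2 * p := by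
  obtain ⟨hfin, hcard⟩ := card_closure_singleton_le ha
  have key := card_closure_le_of_zpowers (T := {a, b})
    (Subgroup.subset_closure (Set.mem_singleton a)) ha hb hp hab
    (by rintro t (rfl | rfl) <;> assumption) (by rintro t (rfl | rfl) <;> simp)
  exact ⟨key.1, key.2.trans (Nat.mul_le_mul_right _ hcard)⟩

/-- Three involutions `a, b, c` with `(ab)ᵖ = (bc)^q = 1` and `a, c` commuting generate at most
`2pq` elements once conjugation by `a` centralizes or inverts `(bc)²`. -/
theorem card_closure_triple_le {G : Type*} [Group G] {a b c : G} {p q : ℕ} (ha : a * a = 1)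
    (hb : b * b = 1) (hc : c * c = 1) (hp : 0 < p) (hq : 0 < q) (hab : (a * b) ^ p = 1)
    (hbc : (b * c) ^ q = 1) (hac : Commute a c)
    (h : SemiconjBy a ((b * c) ^ (2 : ℤ)) ((b * c) ^ (2 : ℤ)) ∨
      SemiconjBy a ((b * c) ^ (2 : ℤ)) ((b * c) ^ (-2 : ℤ))) :
    Finite (Subgroup.closure {a, b, c}) ∧ Nat.card (Subgroup.closure {a, b, c}) ≤ 2 * p * q := by
  obtain ⟨hfin, hcard⟩ := card_closure_pair_le ha hb hp hab
  have haH : a ∈ Subgroup.closure {a, b} := Subgroup.subset_closure (by simp)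
  have hbH : b ∈ Subgroup.closure {a, b} := Subgroup.subset_closure (by simp)
  obtain ⟨hb1, hc1⟩ := semiconjBy_mul_inv_of_involutions hb hc
  have heven : ∀ m : ℤ, ∃ l : ℤ, (b * c) ^ (2 * m) * a = a * (b * c) ^ (2 * l) := by
    intro m
    rcases h with h | h
    · refine ⟨m, ?_⟩
      have := (h.zpow_right m).eq
      rw [← zpow_mul] at this
      exact this.symm
    · refine ⟨-m, ?_⟩
      have := (h.zpow_right (-m)).eq
      rw [← zpow_mul, ← zpow_mul] at this
      rw [this]
      congr 2
      ring
  have key := card_closure_le_of_zpowers (T := {a, b, c}) hbH hb hc hq hbc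
    (by rintro t (rfl | rfl | rfl) <;> assumption) ?_
  · exact ⟨key.1, key.2.trans (Nat.mul_le_mul_right _ hcard)⟩
  rintro t (rfl | rfl | rfl)
  · refine Or.inr (Or.inr fun k => ?_)
    rcases Int.even_or_odd' k with ⟨m, rfl | rfl⟩
    · obtain ⟨l, hl⟩ := heven m
      exact ⟨t, haH, _, ⟨2 * l, rfl⟩, hl.symm⟩
    · obtain ⟨l, hl⟩ := heven (-m)
      refine ⟨b * t * b, mul_mem (mul_mem hbH haH) hbH, _, ⟨1 + -(2 * l), rfl⟩, ?_⟩
      have h1 : (b * c) ^ (2 * m) * b = b * (b * c) ^ (2 * -m) := by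
        rw [zpow_mul_eq_of_semiconjBy_inv hb1, mul_neg]
      have h2 : (b * c) ^ (2 * l) * c = c * (b * c) ^ (-(2 * l)) :=
        zpow_mul_eq_of_semiconjBy_inv hc1 _
      symm
      calc (b * c) ^ (2 * m + 1) * t
          = (b * c) ^ (2 * m) * b * (c * t) := by rw [zpow_add, zpow_one]; group
        _ = b * ((b * c) ^ (2 * -m) * t) * c := by rw [h1, ← hac.eq]; group
        _ = b * t * ((b * c) ^ (2 * l) * c) := by rw [hl]; group
        _ = b * t * c * (b * c) ^ (-(2 * l)) := by rw [h2]; group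
        _ = b * t * (b * b) * c * (b * c) ^ (-(2 * l)) := by rw [hb, mul_one]
        _ = b * t * b * (b * c) ^ (1 + -(2 * l)) := by
          rw [zpow_add, zpow_one]
          simp only [mul_assoc]
  · simp
  · simp

/-- The Coxeter relations of the string diagram with labels `p 1, …, p (n - 1)`. -/
structure CoxeterStringRel {G : Type*} [Group G] (n : ℕ) (p : ℕ → ℕ) (x : ℕ → G) : Prop where
  sq : ∀ i < n, x i * x i = 1
  pow : ∀ i, i + 1 < n → (x i * x (i + 1)) ^ p (i + 1) = 1
  comm : ∀ i j, i + 2 ≤ j → j < n → Commute (x i) (x j)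

theorem commute_of_involutions {G : Type*} [Group G] {a b : G} (ha : a * a = 1) (hb : b * b = 1)
    (hab : (a * b) ^ 2 = 1) : Commute a b := by
  have h : a * b = (a * b)⁻¹ := by
    rw [eq_inv_iff_mul_eq_one, ← pow_two, hab]
  rwa [mul_inv_rev, inv_eq_of_mul_eq_one_left ha, inv_eq_of_mul_eq_one_left hb] at h

theorem image_Iio_add {G : Type*} (x : ℕ → G) (n m : ℕ) :
    x '' Set.Iio (n + m) = x '' Set.Iio n ∪ (fun i => x (n + i)) '' Set.Iio m := by
  ext g
  simp only [Set.mem_image, Set.mem_Iio, Set.mem_union]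
  constructor
  · rintro ⟨i, hi, rfl⟩
    by_cases h : i < n
    · exact Or.inl ⟨i, h, rfl⟩
    · exact Or.inr ⟨i - n, by omega, by rw [Nat.add_sub_cancel' (by omega)]⟩
  · rintro (⟨i, hi, rfl⟩ | ⟨i, hi, rfl⟩)
    exacts [⟨i, by omega, rfl⟩, ⟨n + i, by omega, rfl⟩]

theorem image_Iio_one {G : Type*} (x : ℕ → G) : x '' Set.Iio 1 = {x 0} := by
  have : Set.Iio 1 = ({0} : Set ℕ) := by ext i; simp
  rw [this, Set.image_singleton]

theorem image_Iio_two {G : Type*} (x : ℕ → G) : x '' Set.Iio 2 = {x 0, x 1} := by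
  have : Set.Iio 2 = ({0, 1} : Set ℕ) := by ext i; simp; omega
  rw [this, Set.image_pair]

namespace CoxeterStringRel

variable {G : Type*} [Group G] {n m : ℕ} {p : ℕ → ℕ} {x : ℕ → G}

theorem mono (h : CoxeterStringRel n p x) (hmn : m ≤ n) : CoxeterStringRel m p x :=
  ⟨fun i hi => h.sq i (by omega), fun i hi => h.pow i (by omega),
    fun i j hij hj => h.comm i j hij (by omega)⟩

theorem commute_of_split (h : CoxeterStringRel (n + m) p x) (hpn : p n = 2) {i j : ℕ} (hi : i < n)
    (hj : j < m) : Commute (x i) (x (n + j)) := by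
  by_cases hij : i + 2 ≤ n + j
  · exact h.comm _ _ hij (by omega)
  · obtain ⟨rfl, rfl⟩ : j = 0 ∧ n = i + 1 := by omega
    refine commute_of_involutions (h.sq _ (by omega)) (h.sq _ (by omega)) ?_
    have := h.pow i (by omega)
    rwa [hpn] at this

theorem card_closure_add_le (h : CoxeterStringRel (n + m) p x) (hpn : p n = 2) {N M : ℕ}
    (hN : Finite (Subgroup.closure (x '' Set.Iio n)) ∧
      Nat.card (Subgroup.closure (x '' Set.Iio n)) ≤ N)
    (hM : Finite (Subgroup.closure ((fun i => x (n + i)) '' Set.Iio m)) ∧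
      Nat.card (Subgroup.closure ((fun i => x (n + i)) '' Set.Iio m)) ≤ M) :
    Finite (Subgroup.closure (x '' Set.Iio (n + m))) ∧
      Nat.card (Subgroup.closure (x '' Set.Iio (n + m))) ≤ N * M := by
  obtain ⟨hNf, hN⟩ := hN
  obtain ⟨hMf, hM⟩ := hM
  rw [image_Iio_add]
  have key := card_closure_union_le (S := x '' Set.Iio n)
    (T := (fun i => x (n + i)) '' Set.Iio m) ?_ ?_ ?_
  · exact ⟨key.1, key.2.trans (Nat.mul_le_mul hN hM)⟩
  · rintro _ ⟨i, hi, rfl⟩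
    exact h.sq i (by have := Set.mem_Iio.1 hi; omega)
  · rintro _ ⟨i, hi, rfl⟩
    exact h.sq _ (by have := Set.mem_Iio.1 hi; omega)
  · rintro _ ⟨i, hi, rfl⟩ _ ⟨j, hj, rfl⟩
    exact h.commute_of_split hpn hi hj

theorem card_closure_le (h : CoxeterStringRel n p x) (hp0 : p 0 = 2) (hp : ∀ k < n, 0 < p k)
    (hadj : ∀ k, k + 1 < n → p k = 2 ∨ p (k + 1) = 2) :
    Finite (Subgroup.closure (x '' Set.Iio n)) ∧
      Nat.card (Subgroup.closure (x '' Set.Iio n)) ≤ ∏ k ∈ Finset.range n, p k := by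
  induction n using Nat.strong_induction_on with
  | _ n ih =>
  match n with
  | 0 =>
    have : x '' Set.Iio 0 = ∅ := by simp
    rw [this, Subgroup.closure_empty]
    exact ⟨inferInstance, by simp⟩
  | m + 1 =>
    by_cases hm : p m = 2
    · rw [Finset.prod_range_succ]
      refine h.card_closure_add_le hm (ih m (by omega) (h.mono (by omega))
        (fun k hk => hp k (by omega)) (fun k hk => hadj k (by omega))) ?_
      rw [image_Iio_one, hm]
      exact card_closure_singleton_le (h.sq _ (by omega))
    · obtain ⟨k, rfl⟩ : ∃ k, m = k + 1 := ⟨m - 1, by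
        have : m ≠ 0 := by rintro rfl; exact hm hp0
        omega⟩
      have hk : p k = 2 := (hadj k (by omega)).resolve_right hm
      rw [Finset.prod_range_succ, Finset.prod_range_succ, mul_assoc]
      refine h.card_closure_add_le (m := 2) hk (ih k (by omega) (h.mono (by omega))
        (fun k hk => hp k (by omega)) (fun k hk => hadj k (by omega))) ?_
      rw [image_Iio_two, hk]
      exact card_closure_pair_le (h.sq _ (by omega)) (h.sq _ (by omega)) (hp _ (by omega))
        (h.pow k (by omega))

end CoxeterStringRel

/-- `x` generates `G`, satisfies the Coxeter relations of a string diagram, and `G` is as large as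
these relations allow when no two adjacent labels exceed `2`. -/
structure CoxeterStringModel {G : Type*} [Group G] (n : ℕ) (p : ℕ → ℕ) (x : ℕ → G) : Prop
    extends CoxeterStringRel n p x where
  closure_eq_top : Subgroup.closure (x '' Set.Iio n) = ⊤
  card_eq : Nat.card G = ∏ k ∈ Finset.range n, p k
  ne_one : ∀ i < n, x i ≠ 1
  dvd_orderOf : ∀ i, i + 1 < n → p (i + 1) ∣ orderOf (x i * x (i + 1))

theorem Subgroup.eq_top_of_inl_inr_mem {G K : Type*} [Group G] [Group K] {S : Set G} {T : Set K}
    (hS : Subgroup.closure S = ⊤) (hT : Subgroup.closure T = ⊤) {R : Subgroup (G × K)}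
    (hSR : ∀ s ∈ S, (s, 1) ∈ R) (hTR : ∀ t ∈ T, (1, t) ∈ R) : R = ⊤ := by
  have h1 : R.comap (MonoidHom.inl G K) = ⊤ :=
    top_le_iff.1 (hS ▸ (Subgroup.closure_le _).2 hSR)
  have h2 : R.comap (MonoidHom.inr G K) = ⊤ :=
    top_le_iff.1 (hT ▸ (Subgroup.closure_le _).2 hTR)
  refine (Subgroup.eq_top_iff' R).2 fun ⟨g, k⟩ => ?_
  have hg : (g, 1) ∈ R := (Subgroup.eq_top_iff' _).1 h1 g
  have hk : (1, k) ∈ R := (Subgroup.eq_top_iff' _).1 h2 k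
  simpa using mul_mem hg hk

theorem CoxeterStringModel.prod {G K : Type*} [Group G] [Group K] {n m : ℕ} {p : ℕ → ℕ}
    {x : ℕ → G} {y : ℕ → K} (hx : CoxeterStringModel n p x)
    (hy : CoxeterStringModel m (fun k => p (n + k)) y) (hpn : p n = 2) :
    CoxeterStringModel (n + m) p (fun i => if i < n then (x i, 1) else (1, y (i - n))) where
  sq i hi := by
    split_ifs with h
    · simp [Prod.ext_iff, hx.sq i h]
    · simp [Prod.ext_iff, hy.sq (i - n) (by omega)]
  pow i hi := by
    rcases lt_trichotomy (i + 1) n with h | rfl | h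
    · simp [h, show i < n by omega, Prod.ext_iff, hx.pow i h]
    · simp [Prod.ext_iff, hpn, pow_two, hx.sq i (by omega), hy.sq 0 (by omega)]
    · obtain ⟨j, rfl⟩ : ∃ j, i = n + j := ⟨i - n, by omega⟩
      have := hy.pow j (by omega)
      simp [Prod.ext_iff, add_assoc, this]
  comm i j hij hj := by
    by_cases h : j < n
    · have := (hx.comm i j hij h).eq
      simp [h, show i < n by omega, Commute, SemiconjBy, this]
    · by_cases h' : i < n
      · simp [h, h', Commute, SemiconjBy]
      · have := (hy.comm (i - n) (j - n) (by omega) (by omega)).eq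
        simp [h, h', Commute, SemiconjBy, this]
  closure_eq_top := by
    refine Subgroup.eq_top_of_inl_inr_mem hx.closure_eq_top hy.closure_eq_top ?_ ?_
    · rintro _ ⟨i, hi, rfl⟩
      have hi' : i < n := hi
      exact Subgroup.subset_closure ⟨i, Set.mem_Iio.2 (by omega), by simp [hi']⟩
    · rintro _ ⟨i, hi, rfl⟩
      have hi' : i < m := hi
      exact Subgroup.subset_closure ⟨n + i, Set.mem_Iio.2 (by omega), by simp⟩
  card_eq := by rw [Nat.card_prod, hx.card_eq, hy.card_eq, Finset.prod_range_add]
  ne_one i hi := by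
    split_ifs with h
    · simpa [Prod.ext_iff] using hx.ne_one i h
    · simpa [Prod.ext_iff] using hy.ne_one (i - n) (by omega)
  dvd_orderOf i hi := by
    rcases lt_trichotomy (i + 1) n with h | rfl | h
    · refine (hx.dvd_orderOf i h).trans ?_
      simpa [h, show i < n by omega] using
        orderOf_fst_dvd_orderOf (x := ((x i * x (i + 1), 1) : G × K))
    · have hne : ((x i, y 0) : G × K) ≠ 1 := by
        simp [Prod.ext_iff, hx.ne_one i (by omega)]
      have hsq : ((x i, y 0) : G × K) ^ 2 = 1 := by
        simp [Prod.ext_iff, pow_two, hx.sq i (by omega), hy.sq 0 (by omega)]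
      simp [hpn, orderOf_eq_prime hsq hne]
    · obtain ⟨j, rfl⟩ : ∃ j, i = n + j := ⟨i - n, by omega⟩
      refine (hy.dvd_orderOf j (by omega)).trans ?_
      simpa [add_assoc] using
        orderOf_snd_dvd_orderOf (x := ((1, y j * y (j + 1)) : G × K))

namespace DihedralGroup

theorem closure_sr_zero_sr_one (n : ℕ) :
    Subgroup.closure {(sr 0 : DihedralGroup n), sr 1} = ⊤ := by
  set R := Subgroup.closure {(sr 0 : DihedralGroup n), sr 1}
  have h0 : sr 0 ∈ R := Subgroup.subset_closure (by simp)
  have h1 : sr 1 ∈ R := Subgroup.subset_closure (by simp)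
  have hr : ∀ i : ZMod n, r i ∈ R := by
    intro i
    obtain ⟨k, rfl⟩ := ZMod.intCast_surjective i
    rw [← r_one_zpow]
    refine zpow_mem ?_ k
    simpa using mul_mem h0 h1
  refine (Subgroup.eq_top_iff' R).2 ?_
  rintro (i | i)
  · exact hr i
  · simpa using mul_mem h0 (hr i)

theorem sr_ne_one {n : ℕ} (i : ZMod n) : sr i ≠ 1 := nofun

end DihedralGroup

open DihedralGroup in
theorem coxeterStringModel_one {p : ℕ → ℕ} (hp : p 0 = 2) :
    CoxeterStringModel 1 p (fun _ => (sr 0 : DihedralGroup 1)) where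
  sq i hi := by simp
  pow i hi := by omega
  comm i j hij hj := by omega
  closure_eq_top := by
    rw [image_Iio_one, ← closure_sr_zero_sr_one, Subsingleton.elim (1 : ZMod 1) 0,
      Set.pair_eq_singleton]
  card_eq := by rw [DihedralGroup.nat_card]; simp [hp]
  ne_one i hi := sr_ne_one _
  dvd_orderOf i hi := by omega

open DihedralGroup in
theorem coxeterStringModel_two {p : ℕ → ℕ} (hp : p 0 = 2) :
    CoxeterStringModel 2 p (fun i => (sr i : DihedralGroup (p 1))) where
  sq i hi := by simp
  pow i hi := by
    obtain rfl : i = 0 := by omega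
    simp
  comm i j hij hj := by omega
  closure_eq_top := by
    rw [image_Iio_two, ← closure_sr_zero_sr_one]
    simp
  card_eq := by rw [DihedralGroup.nat_card]; simp [hp, Finset.prod_range_succ]
  ne_one i hi := sr_ne_one _
  dvd_orderOf i hi := by
    obtain rfl : i = 0 := by omega
    simp

theorem exists_coxeterStringModel (n : ℕ) {p : ℕ → ℕ} (hp0 : p 0 = 2)
    (hadj : ∀ k, k + 1 < n → p k = 2 ∨ p (k + 1) = 2) :
    ∃ (G : Type) (_ : Group G) (x : ℕ → G), CoxeterStringModel n p x := by
  induction n using Nat.strong_induction_on with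
  | _ n ih =>
  match n with
  | 0 =>
    exact ⟨PUnit, inferInstance, fun _ => 1, ⟨nofun, nofun, nofun⟩, Subsingleton.elim _ _,
      by simp, nofun, nofun⟩
  | m + 1 =>
    by_cases hm : p m = 2
    · obtain ⟨G, _, x, hx⟩ := ih m (by omega) (fun k hk => hadj k (by omega))
      exact ⟨_, _, _, hx.prod (coxeterStringModel_one (p := fun k => p (m + k)) hm) hm⟩
    · obtain ⟨k, rfl⟩ : ∃ k, m = k + 1 := ⟨m - 1, by
        have : m ≠ 0 := by rintro rfl; exact hm hp0
        omega⟩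
      have hk : p k = 2 := (hadj k (by omega)).resolve_right hm
      obtain ⟨G, _, x, hx⟩ := ih k (by omega) (fun k hk => hadj k (by omega))
      exact ⟨_, _, _, hx.prod (coxeterStringModel_two (p := fun i => p (k + i)) hk) hk⟩

/-- A target group for `Γ` that is large enough, together with a matching upper bound, determines
the order of `Γ` and of the products of consecutive generators. -/
theorem orderOf_and_card_gamma_of_model {n : ℕ} {p : ℕ → ℕ} {N : ℕ} {G : Type*} [Group G]
    {y : Fin n → G} (hup : Finite (Gamma n p) ∧ Nat.card (Gamma n p) ≤ N)
    (hrel : ∀ w ∈ gammaRels n p, FreeGroup.lift y w = 1)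
    (hcard : N ≤ Nat.card (Subgroup.closure (Set.range y)))
    (hord : ∀ i j : Fin n, (i : ℕ) + 1 = j → p j ∣ orderOf (y i * y j)) :
    (∀ i j : Fin n, (i : ℕ) + 1 = (j : ℕ) → orderOf (xg n p i * xg n p j) = p (j : ℕ)) ∧
    Nat.card (Gamma n p) = N := by
  obtain ⟨hfin, hup⟩ := hup
  set f : Gamma n p →* G := PresentedGroup.toGroup hrel
  have hf : ∀ i, f (xg n p i) = y i := fun i => PresentedGroup.toGroup.of hrel
  refine ⟨fun i j hij => ?_, hup.antisymm (hcard.trans ?_)⟩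
  · refine Nat.dvd_antisymm (orderOf_dvd_of_pow_eq_one ?_) ((hord i j hij).trans ?_)
    · exact PresentedGroup.one_of_mem (Or.inr (Or.inl ⟨i, j, hij, rfl⟩))
    · rw [← hf, ← hf, ← map_mul]
      exact orderOf_map_dvd f _
  · have hle : Subgroup.closure (Set.range y) ≤ f.range := by
      rw [Subgroup.closure_le]
      rintro _ ⟨i, rfl⟩
      exact ⟨_, hf i⟩
    have : Finite f.range := Finite.of_surjective _ f.rangeRestrict_surjective
    exact (Nat.card_mono (Set.toFinite (f.range : Set G)) hle).trans
      (Nat.card_le_card_of_surjective _ f.rangeRestrict_surjective)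

theorem closure_range_xg (n : ℕ) (p : ℕ → ℕ) : Subgroup.closure (Set.range (xg n p)) = ⊤ :=
  PresentedGroup.closure_range_of _

theorem lift_xg_eq_one {n : ℕ} {p : ℕ → ℕ} {w : FreeGroup (Fin n)} (hw : w ∈ gammaRels n p) :
    FreeGroup.lift (xg n p) w = 1 := by
  have : FreeGroup.lift (xg n p) = PresentedGroup.mk (gammaRels n p) := by
    ext i
    simp [xg, PresentedGroup.of]
  rw [this]
  exact PresentedGroup.one_of_mem hw

theorem xg_mul_self {n : ℕ} (p : ℕ → ℕ) (i : Fin n) : xg n p i * xg n p i = 1 := by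
  simpa [pow_two] using lift_xg_eq_one (p := p) (Or.inl ⟨i, rfl⟩)

theorem xg_mul_xg_pow {n : ℕ} (p : ℕ → ℕ) {i j : Fin n} (hij : (i : ℕ) + 1 = j) :
    (xg n p i * xg n p j) ^ p j = 1 := by
  simpa using lift_xg_eq_one (p := p) (Or.inr (Or.inl ⟨i, j, hij, rfl⟩))

theorem xg_commute {n : ℕ} (p : ℕ → ℕ) {i j : Fin n} (hij : (i : ℕ) + 2 ≤ j) :
    Commute (xg n p i) (xg n p j) :=
  commute_of_involutions (xg_mul_self p i) (xg_mul_self p j) (by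
    simpa using lift_xg_eq_one (p := p) (Or.inr (Or.inr (Or.inl ⟨i, j, hij, rfl⟩))))

theorem mul_conj_sq_eq_one {G : Type*} [Group G] {a b c : G} (ha : a * a = 1) (hb : b * b = 1)
    (hc : c * c = 1) (hac : Commute a c) (h : Commute a b ∨ Commute b c) :
    (a * b * c * b) ^ 2 = 1 := by
  have hac2 : (a * c) ^ 2 = 1 := by
    rw [hac.mul_pow, pow_two, pow_two, ha, hc, one_mul]
  rcases h with h | h
  · have : a * b * c * b = b * (a * c) * b⁻¹ := by
      rw [h.eq, inv_eq_of_mul_eq_one_left hb, mul_assoc b]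
    rw [this, conj_pow, hac2, mul_one, mul_inv_cancel]
  · rw [mul_assoc (a * b), ← h.eq, mul_assoc a, ← mul_assoc b, hb, one_mul, hac2]

theorem mul_comm_sq_eq_one {G : Type*} [Group G] {a b c : G} (ha : a * a = 1) (hb : b * b = 1)
    (hc : c * c = 1) (h : Commute b c) : (a * b * c * b * c) ^ 2 = 1 := by
  have : a * b * c * b * c = a := by
    rw [mul_assoc _ b c, h.eq, mul_assoc (a * b), ← mul_assoc c, hc, one_mul, mul_assoc, hb,
      mul_one]
  rw [this, pow_two, ha]

/-- When no two adjacent labels exceed `2`, the Coxeter relations imply those of `Γ`. -/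
theorem CoxeterStringRel.lift_eq_one {G : Type*} [Group G] {n : ℕ} {p : ℕ → ℕ} {x : ℕ → G}
    (h : CoxeterStringRel n p x) (hadj : ∀ k, 1 ≤ k → k + 1 < n → p k = 2 ∨ p (k + 1) = 2)
    {w : FreeGroup (Fin n)} (hw : w ∈ gammaRels n p) :
    FreeGroup.lift (fun i : Fin n => x i) w = 1 := by
  rcases hw with ⟨i, rfl⟩ | ⟨i, j, hij, rfl⟩ | ⟨i, j, hij, rfl⟩ | ⟨a, b, c, hab, hbc, hw⟩
  · simpa [pow_two] using h.sq i i.2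
  · have := h.pow i (by omega)
    simpa [← hij] using this
  · have hc := h.comm i j hij j.2
    have hsq : (x i * x j) ^ 2 = 1 := by
      rw [hc.mul_pow, pow_two, pow_two, h.sq i i.2, h.sq j j.2, one_mul]
    simpa using hsq
  · have ha1 := h.sq a a.2
    have hb1 := h.sq b b.2
    have hc1 := h.sq c c.2
    have hac := h.comm a c (by omega) c.2
    have hcomm : ∀ i j : Fin n, (i : ℕ) + 1 = j → p j = 2 → Commute (x i) (x j) := by
      intro i j hij hj
      have := h.pow i (by omega)
      rw [hij, hj] at this
      exact commute_of_involutions (h.sq i i.2) (h.sq j j.2) this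
    have hadj' : p b = 2 ∨ p c = 2 := by
      rw [← hbc]
      exact hadj b (by omega) (by omega)
    rcases hw with ⟨-, -, rfl⟩ | ⟨hb, -, rfl⟩ | ⟨-, hc, rfl⟩
    · simpa using mul_conj_sq_eq_one ha1 hb1 hc1 hac (hadj'.imp (hcomm a b hab) (hcomm b c hbc))
    · have hc2 : p c = 2 := hadj'.resolve_left fun h2 => by
        rw [h2] at hb
        exact absurd hb (by decide)
      simpa using mul_comm_sq_eq_one ha1 hb1 hc1 (hcomm b c hbc hc2)
    · have hb2 : p b = 2 := hadj'.resolve_right fun h2 => by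
        rw [h2] at hc
        exact absurd hc (by decide)
      simpa using mul_comm_sq_eq_one hc1 hb1 ha1 (hcomm a b hab hb2).symm

theorem two_mul_prod_Icc {n : ℕ} (hn : 1 ≤ n) (p : ℕ → ℕ) :
    2 * ∏ k ∈ Finset.Icc 1 (n - 1), p k =
      ∏ k ∈ Finset.range n, Function.update p 0 2 k := by
  obtain ⟨m, rfl⟩ : ∃ m, n = m + 1 := ⟨n - 1, by omega⟩
  rw [Finset.prod_range_succ', mul_comm, Nat.add_sub_cancel, Finset.range_eq_Ico,
    Finset.prod_Ico_add' (fun k => Function.update p 0 2 k) 0 m 1]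
  congr 1
  refine Finset.prod_congr (by ext; simp) fun k hk => ?_
  have := (Finset.mem_Icc.1 hk).1
  rw [Function.update_of_ne (by omega)]

theorem gamma_of_adjacent_eq_two {n : ℕ} (hn : 1 ≤ n) {p : ℕ → ℕ}
    (hp : ∀ k, 1 ≤ k → k ≤ n - 1 → 2 ≤ p k)
    (hadj : ∀ k, 1 ≤ k → k + 1 < n → p k = 2 ∨ p (k + 1) = 2) :
    (∀ i j : Fin n, (i : ℕ) + 1 = (j : ℕ) → orderOf (xg n p i * xg n p j) = p (j : ℕ)) ∧
    Nat.card (Gamma n p) = 2 * ∏ k ∈ Finset.Icc 1 (n - 1), p k := by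
  set p' := Function.update p 0 2 with hp'
  have hp'0 : p' 0 = 2 := by simp [hp']
  have hp's : ∀ k, p' (k + 1) = p (k + 1) := fun k => by simp [hp']
  have hadj' : ∀ k, k + 1 < n → p' k = 2 ∨ p' (k + 1) = 2 := by
    rintro (_ | k) hk
    · exact Or.inl hp'0
    · rw [hp's, hp's]
      exact hadj _ (by omega) hk
  rw [two_mul_prod_Icc hn]
  obtain ⟨G, _, y, hy⟩ := exists_coxeterStringModel n hp'0 hadj'
  have hy' : CoxeterStringRel n p y := ⟨hy.sq, fun i hi => hp's i ▸ hy.pow i hi, hy.comm⟩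
  refine orderOf_and_card_gamma_of_model (y := fun i : Fin n => y i) ?_
    (fun w hw => hy'.lift_eq_one hadj hw) ?_ ?_
  · set x : ℕ → Gamma n p := fun i => if h : i < n then xg n p ⟨i, h⟩ else 1 with hx
    have hxi : ∀ i (h : i < n), x i = xg n p ⟨i, h⟩ := fun i h => by simp [hx, h]
    have hxrel : CoxeterStringRel n p' x := by
      refine ⟨fun i hi => ?_, fun i hi => ?_, fun i j hij hj => ?_⟩
      · rw [hxi i hi]
        exact xg_mul_self p _
      · rw [hxi i (by omega), hxi _ hi, hp's]
        exact xg_mul_xg_pow p (i := ⟨i, by omega⟩) (j := ⟨i + 1, hi⟩) rfl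
      · rw [hxi i (by omega), hxi j hj]
        exact xg_commute p hij
    have htop : Subgroup.closure (x '' Set.Iio n) = ⊤ := by
      rw [← closure_range_xg n p]
      congr 1
      ext g
      constructor
      · rintro ⟨i, hi, rfl⟩
        exact ⟨⟨i, hi⟩, (hxi i hi).symm⟩
      · rintro ⟨i, rfl⟩
        exact ⟨i, i.2, hxi i i.2⟩
    have key := hxrel.card_closure_le hp'0 ?_ hadj'
    · rw [htop, Subgroup.card_top] at key
      exact ⟨(Equiv.finite_iff Subgroup.topEquiv.toEquiv).1 key.1, key.2⟩
    · rintro (_ | k) hk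
      · simp [hp'0]
      · rw [hp's]
        exact two_pos.trans_le (hp _ (by omega) (by omega))
  · have : Set.range (fun i : Fin n => y i) = y '' Set.Iio n := by
      ext g
      constructor
      · rintro ⟨i, rfl⟩
        exact ⟨i, i.2, rfl⟩
      · rintro ⟨i, hi, rfl⟩
        exact ⟨⟨i, hi⟩, rfl⟩
    rw [this, hy.closure_eq_top, Subgroup.card_top, hy.card_eq]
  · intro i j hij
    rw [← hij, ← hp's]
    exact hy.dvd_orderOf i (by omega)

theorem semiconjBy_of_mul_conj_sq {G : Type*} [Group G] {a b c : G} (ha : a * a = 1)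
    (hb : b * b = 1) (hc : c * c = 1) (hac : Commute a c) (h : (a * b * c * b) ^ 2 = 1) :
    SemiconjBy a ((b * c) ^ (2 : ℤ)) ((b * c) ^ (2 : ℤ)) := by
  have hbcb : Commute a (b * c * b) := by
    refine commute_of_involutions ha ?_ (by simpa only [mul_assoc] using h)
    calc b * c * b * (b * c * b) = b * (c * (b * b) * c) * b := by simp only [mul_assoc]
      _ = 1 := by rw [hb, mul_one, hc, mul_one, hb]
  have : (b * c) ^ (2 : ℤ) = b * c * b * c := by rw [zpow_two, ← mul_assoc]
  rw [this]
  exact hbcb.mul_right hac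

theorem semiconjBy_of_mul_comm_sq {G : Type*} [Group G] {a b c : G} (ha : a * a = 1)
    (h : (a * b * c * b * c) ^ 2 = 1) :
    SemiconjBy a ((b * c) ^ (2 : ℤ)) ((b * c) ^ (-2 : ℤ)) := by
  have h2 : (b * c) ^ (2 : ℤ) = b * c * b * c := by rw [zpow_two, ← mul_assoc]
  have h3 : a * (b * c) ^ (2 : ℤ) * (a * (b * c) ^ (2 : ℤ)) = 1 := by
    rw [h2, ← pow_two]
    simpa only [mul_assoc] using h
  have h4 : a * (b * c) ^ (2 : ℤ) * a = (b * c) ^ (-2 : ℤ) := by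
    rw [zpow_neg, eq_inv_iff_mul_eq_one, mul_assoc, h3]
  rw [SemiconjBy, ← h4, mul_assoc _ a a, ha, mul_one]

theorem Fin.range_three {G : Type*} (y : Fin 3 → G) : Set.range y = {y 0, y 1, y 2} := by
  ext g
  simp [Fin.exists_fin_succ, eq_comm]

theorem card_gamma_three_le {p : ℕ → ℕ} (hp1 : 0 < p 1) (hp2 : 0 < p 2)
    (hpar : Even (p 1) ∨ Even (p 2)) :
    Finite (Gamma 3 p) ∧ Nat.card (Gamma 3 p) ≤ 2 * (p 1 * p 2) := by
  set a := xg 3 p 0 with ha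
  set b := xg 3 p 1 with hb
  set c := xg 3 p 2 with hc
  have ha1 : a * a = 1 := xg_mul_self p 0
  have hb1 : b * b = 1 := xg_mul_self p 1
  have hc1 : c * c = 1 := xg_mul_self p 2
  have hab : (a * b) ^ p 1 = 1 := xg_mul_xg_pow p (i := (0 : Fin 3)) (j := 1) rfl
  have hbc : (b * c) ^ p 2 = 1 := xg_mul_xg_pow p (i := (1 : Fin 3)) (j := 2) rfl
  have hac : Commute a c := xg_commute p (i := (0 : Fin 3)) (j := 2) le_rfl
  have htop : Subgroup.closure {a, b, c} = ⊤ := by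
    rw [← closure_range_xg 3 p, Fin.range_three]
  have hext : ∀ {w}, _ → FreeGroup.lift (xg 3 p) w = 1 := fun {w} hw =>
    lift_xg_eq_one (Or.inr (Or.inr (Or.inr ⟨0, 1, 2, rfl, rfl, hw⟩)))
  have key : Finite (Subgroup.closure {a, b, c}) ∧
      Nat.card (Subgroup.closure {a, b, c}) ≤ 2 * (p 1 * p 2) := by
    rw [← mul_assoc]
    rcases Nat.even_or_odd (p 1) with h1 | h1
    · rcases Nat.even_or_odd (p 2) with h2 | h2
      · have h := hext (Or.inl ⟨h1, h2, rfl⟩)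
        simp only [map_pow, map_mul, FreeGroup.lift_apply_of] at h
        exact card_closure_triple_le ha1 hb1 hc1 hp1 hp2 hab hbc hac
          (Or.inl (semiconjBy_of_mul_conj_sq ha1 hb1 hc1 hac h))
      · have h := hext (Or.inr (Or.inr ⟨h1, h2, rfl⟩))
        simp only [map_pow, map_mul, FreeGroup.lift_apply_of] at h
        have hset : ({a, b, c} : Set (Gamma 3 p)) = {c, b, a} := by
          ext g
          simp only [Set.mem_insert_iff, Set.mem_singleton_iff]
          tauto
        have hrev : ∀ {u v : Gamma 3 p} {k : ℕ}, u * u = 1 → v * v = 1 → (u * v) ^ k = 1 →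
            (v * u) ^ k = 1 := fun {u v k} hu hv huv => by
          rw [← inv_eq_one, ← inv_pow, mul_inv_rev, inv_eq_of_mul_eq_one_left hu,
            inv_eq_of_mul_eq_one_left hv, huv]
        rw [hset, mul_right_comm]
        exact card_closure_triple_le hc1 hb1 ha1 hp2 hp1 (hrev hb1 hc1 hbc) (hrev ha1 hb1 hab)
          hac.symm (Or.inr (semiconjBy_of_mul_comm_sq hc1 h))
    · have h2 := hpar.resolve_left (Nat.not_even_iff_odd.2 h1)
      have h := hext (Or.inr (Or.inl ⟨h1, h2, rfl⟩))
      simp only [map_pow, map_mul, FreeGroup.lift_apply_of] at h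
      exact card_closure_triple_le ha1 hb1 hc1 hp1 hp2 hab hbc hac
        (Or.inr (semiconjBy_of_mul_comm_sq ha1 h))
  rw [htop, Subgroup.card_top] at key
  exact ⟨(Equiv.finite_iff Subgroup.topEquiv.toEquiv).1 key.1, key.2⟩

/-- For `n = 3` it suffices to find a large enough triple satisfying the relations of `Γ`. -/
theorem gamma_three_of_triple {p : ℕ → ℕ} (hp1 : 0 < p 1) (hp2 : 0 < p 2)
    (hpar : Even (p 1) ∨ Even (p 2)) {G : Type*} [Group G] {a b c : G} (ha : a * a = 1)
    (hb : b * b = 1) (hc : c * c = 1) (hac : (a * c) ^ 2 = 1)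
    (hab : orderOf (a * b) = p 1) (hbc : orderOf (b * c) = p 2)
    (hee : Even (p 1) → Even (p 2) → (a * b * c * b) ^ 2 = 1)
    (hoe : Odd (p 1) → Even (p 2) → (a * b * c * b * c) ^ 2 = 1)
    (heo : Even (p 1) → Odd (p 2) → (c * b * a * b * a) ^ 2 = 1)
    (hcard : 2 * (p 1 * p 2) ≤ Nat.card (Subgroup.closure {a, b, c})) :
    (∀ i j : Fin 3, (i : ℕ) + 1 = (j : ℕ) → orderOf (xg 3 p i * xg 3 p j) = p (j : ℕ)) ∧
    Nat.card (Gamma 3 p) = 2 * (p 1 * p 2) := by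
  have hsucc : ∀ {i j : Fin 3}, (i : ℕ) + 1 = j → (i = 0 ∧ j = 1) ∨ (i = 1 ∧ j = 2) := by
    decide
  refine orderOf_and_card_gamma_of_model (y := ![a, b, c]) (card_gamma_three_le hp1 hp2 hpar)
    ?_ ?_ ?_
  · rintro w (⟨i, rfl⟩ | ⟨i, j, hij, rfl⟩ | ⟨i, j, hij, rfl⟩ | ⟨i, j, k, hij, hjk, hw⟩)
    · fin_cases i <;> simpa [pow_two]
    · rcases hsucc hij with ⟨rfl, rfl⟩ | ⟨rfl, rfl⟩
      · simp [← hab, pow_orderOf_eq_one]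
      · simp [← hbc, pow_orderOf_eq_one]
    · obtain ⟨rfl, rfl⟩ : i = 0 ∧ j = 2 := by omega
      simpa using hac
    · obtain ⟨rfl, rfl, rfl⟩ : i = 0 ∧ j = 1 ∧ k = 2 := by omega
      rcases hw with ⟨h1, h2, rfl⟩ | ⟨h1, h2, rfl⟩ | ⟨h1, h2, rfl⟩
      · simpa using hee h1 h2
      · simpa using hoe h1 h2
      · simpa using heo h1 h2
  · rw [Fin.range_three]
    exact hcard
  · intro i j hij
    rcases hsucc hij with ⟨rfl, rfl⟩ | ⟨rfl, rfl⟩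
    · exact hab.symm.dvd
    · exact hbc.symm.dvd

open DihedralGroup in
theorem eq_top_of_dihedral_prod {m k : ℕ} {R : Subgroup (DihedralGroup m × DihedralGroup k)}
    (h1 : (sr 0, 1) ∈ R) (h2 : (sr 1, 1) ∈ R) (h3 : (1, sr 0) ∈ R) (h4 : (1, sr 1) ∈ R) :
    R = ⊤ := by
  refine Subgroup.eq_top_of_inl_inr_mem (closure_sr_zero_sr_one m) (closure_sr_zero_sr_one k)
    ?_ ?_ <;> rintro _ (rfl | rfl) <;> assumption

open DihedralGroup Pointwise in
theorem gamma_three_of_even_even {p : ℕ → ℕ} (hp1 : 0 < p 1) (hp2 : 0 < p 2)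
    (h1 : Even (p 1)) (h2 : Even (p 2)) :
    (∀ i j : Fin 3, (i : ℕ) + 1 = (j : ℕ) → orderOf (xg 3 p i * xg 3 p j) = p (j : ℕ)) ∧
    Nat.card (Gamma 3 p) = 2 * (p 1 * p 2) := by
  have : NeZero (p 1) := ⟨hp1.ne'⟩
  have : NeZero (p 2) := ⟨hp2.ne'⟩
  set a : DihedralGroup (p 1) × DihedralGroup (p 2) := (sr 0, 1) with ha
  set b : DihedralGroup (p 1) × DihedralGroup (p 2) := (sr 1, sr 0) with hb
  set c : DihedralGroup (p 1) × DihedralGroup (p 2) := (1, sr 1) with hc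
  set d : DihedralGroup (p 1) × DihedralGroup (p 2) := (1, sr 0) with hd
  refine gamma_three_of_triple hp1 hp2 (Or.inl h1) (a := a) (b := b) (c := c) ?_ ?_ ?_ ?_ ?_ ?_
    ?_ ?_ ?_ ?_
  · simp [ha, Prod.ext_iff]
  · simp [hb, Prod.ext_iff]
  · simp [hc, Prod.ext_iff]
  · simp [ha, hc, Prod.ext_iff, pow_two]
  · simp only [ha, hb, Prod.mk_mul_mk, sr_mul_sr, one_mul, sub_zero]
    rw [Prod.orderOf_mk, orderOf_r_one, orderOf_sr]
    exact Nat.lcm_eq_left h1.two_dvd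
  · simp only [hb, hc, Prod.mk_mul_mk, sr_mul_sr, mul_one, sub_zero]
    rw [Prod.orderOf_mk, orderOf_r_one, orderOf_sr]
    exact Nat.lcm_eq_right h2.two_dvd
  · intro _ _
    simp [ha, hb, hc, Prod.ext_iff, pow_two]
  · exact fun h => absurd h1 (Nat.not_even_iff_odd.2 h)
  · exact fun _ h => absurd h2 (Nat.not_even_iff_odd.2 h)
  · set R := Subgroup.closure {a, b, c} with hR
    have haR : a ∈ R := Subgroup.subset_closure (by simp)
    have hbR : b ∈ R := Subgroup.subset_closure (by simp)
    have hcR : c ∈ R := Subgroup.subset_closure (by simp)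
    have hd1 : d * d = 1 := by simp [hd, Prod.ext_iff]
    have hb1 : b * b = 1 := by simp [hb, Prod.ext_iff]
    have hda : d * a = a * d := by simp [ha, hd]
    have hdb : d * b = b * d := by simp [hb, hd]
    have hdc : d * c = b * c * b * d := by simp [hb, hc, hd]
    have htop : Subgroup.closure {a, b, c, d} = ⊤ := by
      have ha' : a ∈ Subgroup.closure {a, b, c, d} := Subgroup.subset_closure (by simp)
      have hb' : b ∈ Subgroup.closure {a, b, c, d} := Subgroup.subset_closure (by simp)
      have hc' : c ∈ Subgroup.closure {a, b, c, d} := Subgroup.subset_closure (by simp)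
      have hd' : d ∈ Subgroup.closure {a, b, c, d} := Subgroup.subset_closure (by simp)
      refine eq_top_of_dihedral_prod ha' ?_ hd' hc'
      simpa [hb, hd] using mul_mem hb' hd'
    have key := card_closure_le_of_mul_mem (T := {a, b, c, d}) (A := R) (B := {1, d})
      (Set.toFinite _) (Set.toFinite _) (one_mem R) (by simp) ?_ ?_
    · have hB : Nat.card ({1, d} : Set (DihedralGroup (p 1) × DihedralGroup (p 2))) ≤ 2 := by
        rw [Nat.card_coe_set_eq]
        exact (Set.ncard_insert_le _ _).trans (by simp)
      have hle := key.2.trans (Nat.mul_le_mul_left _ hB)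
      rw [htop, Subgroup.card_top, Nat.card_prod, DihedralGroup.nat_card,
        DihedralGroup.nat_card, SetLike.coe_sort_coe] at hle
      nlinarith
    · rintro t (rfl | rfl | rfl | rfl)
      · simp [ha, Prod.ext_iff]
      · exact hb1
      · simp [hc, Prod.ext_iff]
      · exact hd1
    · have hmem : ∀ {g}, g ∈ R → g ∈ (R : Set (DihedralGroup (p 1) × DihedralGroup (p 2))) * {1, d} ∧
          g * d ∈ (R : Set (DihedralGroup (p 1) × DihedralGroup (p 2))) * {1, d} :=
        fun {g} hg => ⟨⟨g, hg, 1, by simp, mul_one g⟩, ⟨g, hg, d, by simp, rfl⟩⟩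
      rintro g hg _ (rfl | rfl) t (rfl | rfl | rfl | rfl)
      · rw [mul_one]
        exact (hmem (mul_mem hg haR)).1
      · rw [mul_one]
        exact (hmem (mul_mem hg hbR)).1
      · rw [mul_one]
        exact (hmem (mul_mem hg hcR)).1
      · rw [mul_one]
        exact (hmem hg).2
      · rw [mul_assoc, hda, ← mul_assoc]
        exact (hmem (mul_mem hg haR)).2
      · rw [mul_assoc, hdb, ← mul_assoc]
        exact (hmem (mul_mem hg hbR)).2
      · rw [mul_assoc, hdc, ← mul_assoc]
        exact (hmem (mul_mem hg (mul_mem (mul_mem hbR hcR) hbR))).2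
      · rw [mul_assoc, hd1, mul_one]
        exact (hmem hg).1

open DihedralGroup in
/-- A model of `Γ(m, 2k)` for odd `m` and `k ∣ m`. -/
theorem exists_triple_of_odd {m k : ℕ} (hm : Odd m) (hkm : k ∣ m) :
    ∃ (G : Type) (_ : Group G) (a b c : G), a * a = 1 ∧ b * b = 1 ∧ c * c = 1 ∧
      (a * c) ^ 2 = 1 ∧ orderOf (a * b) = m ∧ orderOf (b * c) = 2 * k ∧
      (a * b * c * b * c) ^ 2 = 1 ∧ 2 * (m * (2 * k)) ≤ Nat.card (Subgroup.closure {a, b, c}) := by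
  obtain ⟨l, hl⟩ : Odd k := hm.of_dvd_nat hkm
  have hr : orderOf (r (-1) : DihedralGroup k) = k := by
    rw [← inv_r, orderOf_inv, orderOf_r_one]
  refine ⟨DihedralGroup m × DihedralGroup k, inferInstance, (sr 0, sr 0), (sr 1, sr 1),
    (1, sr 0), ?_, ?_, ?_, ?_, ?_, ?_, ?_, ?_⟩
  · simp [Prod.ext_iff]
  · simp [Prod.ext_iff]
  · simp [Prod.ext_iff]
  · simp [Prod.ext_iff, pow_two]
  · simp only [Prod.mk_mul_mk, sr_mul_sr, sub_zero]
    rw [Prod.orderOf_mk, orderOf_r_one, orderOf_r_one]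
    exact Nat.lcm_eq_left hkm
  · simp only [Prod.mk_mul_mk, sr_mul_sr, mul_one, zero_sub]
    rw [Prod.orderOf_mk, hr, orderOf_sr]
    exact Nat.Coprime.lcm_eq_mul (Nat.coprime_two_left.2 ⟨l, hl⟩)
  · simp [Prod.ext_iff, pow_two]
  · set R := Subgroup.closure
      {((sr 0, sr 0) : DihedralGroup m × DihedralGroup k), (sr 1, sr 1), (1, sr 0)} with hR
    have ha : (sr 0, sr 0) ∈ R := Subgroup.subset_closure (by simp)
    have hb : (sr 1, sr 1) ∈ R := Subgroup.subset_closure (by simp)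
    have hc : (1, sr 0) ∈ R := Subgroup.subset_closure (by simp)
    have hb1 : (sr 1, 1) ∈ R := by
      have h := pow_mem (mul_mem hb hc) k
      have hs : (sr 1 : DihedralGroup m) ^ k = sr 1 := by
        rw [hl, pow_succ, pow_mul, pow_two, sr_mul_self, one_pow, one_mul]
      have hk : (r (-1) : DihedralGroup k) ^ k = 1 := orderOf_dvd_iff_pow_eq_one.1 hr.dvd
      simpa only [Prod.mk_mul_mk, sr_mul_sr, mul_one, zero_sub, Prod.pow_mk, hs, hk] using h
    have htop : R = ⊤ := by
      refine eq_top_of_dihedral_prod ?_ hb1 hc ?_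
      · simpa using mul_mem ha hc
      · simpa using mul_mem hb1 hb
    rw [htop, Subgroup.card_top, Nat.card_prod, DihedralGroup.nat_card, DihedralGroup.nat_card]
    exact le_of_eq (by ring)

theorem orderOf_mul_of_involutions_comm {G : Type*} [Group G] {a b : G} (ha : a * a = 1)
    (hb : b * b = 1) : orderOf (b * a) = orderOf (a * b) := by
  rw [← orderOf_inv, mul_inv_rev, inv_eq_of_mul_eq_one_left ha, inv_eq_of_mul_eq_one_left hb]

theorem gamma_three_of_odd_even {p : ℕ → ℕ} (hp2 : 0 < p 2) (h1 : Odd (p 1)) (h2 : Even (p 2))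
    (hdvd : p 2 ∣ 2 * p 1) :
    (∀ i j : Fin 3, (i : ℕ) + 1 = (j : ℕ) → orderOf (xg 3 p i * xg 3 p j) = p (j : ℕ)) ∧
    Nat.card (Gamma 3 p) = 2 * (p 1 * p 2) := by
  obtain ⟨k, hk⟩ := h2.two_dvd
  obtain ⟨G, _, a, b, c, ha, hb, hc, hac, hab, hbc, hrel, hcard⟩ :=
    exists_triple_of_odd h1 (Nat.dvd_of_mul_dvd_mul_left two_pos (hk ▸ hdvd))
  exact gamma_three_of_triple h1.pos hp2 (Or.inr h2) ha hb hc hac hab (hbc.trans hk.symm)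
    (fun h => absurd h (Nat.not_even_iff_odd.2 h1)) (fun _ _ => hrel)
    (fun h => absurd h (Nat.not_even_iff_odd.2 h1)) (hk ▸ hcard)

theorem gamma_three_of_even_odd {p : ℕ → ℕ} (hp1 : 0 < p 1) (h1 : Even (p 1)) (h2 : Odd (p 2))
    (hdvd : p 1 ∣ 2 * p 2) :
    (∀ i j : Fin 3, (i : ℕ) + 1 = (j : ℕ) → orderOf (xg 3 p i * xg 3 p j) = p (j : ℕ)) ∧
    Nat.card (Gamma 3 p) = 2 * (p 1 * p 2) := by
  obtain ⟨k, hk⟩ := h1.two_dvd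
  obtain ⟨G, _, a, b, c, ha, hb, hc, hac, hab, hbc, hrel, hcard⟩ :=
    exists_triple_of_odd h2 (Nat.dvd_of_mul_dvd_mul_left two_pos (hk ▸ hdvd))
  refine gamma_three_of_triple (a := c) (b := b) (c := a) hp1 h2.pos (Or.inl h1) hc hb ha ?_
    ((orderOf_mul_of_involutions_comm hb hc).trans (hbc.trans hk.symm))
    ((orderOf_mul_of_involutions_comm ha hb).trans hab)
    (fun _ h => absurd h (Nat.not_even_iff_odd.2 h2))
    (fun h => absurd h1 (Nat.not_even_iff_odd.2 h)) (fun _ _ => hrel) ?_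
  · rw [← (commute_of_involutions ha hc hac).eq, hac]
  · have hset : ({c, b, a} : Set G) = {a, b, c} := by
      ext g
      simp only [Set.mem_insert_iff, Set.mem_singleton_iff]
      tauto
    rwa [hset, hk, mul_comm (2 * k)]

/-- Let `(p_1, …, p_{n-1})` be an admissible tuple such that for every `i` strictly between
`1` and `n-1`, either `p_i = 2` or `p_{i-1} = p_{i+1} = 2`. Then in `Γ(p_1, …, p_{n-1})` the
element `x_{i-1} x_i` has order exactly `p_i` for each `i`, and
`|Γ(p_1, …, p_{n-1})| = 2 p_1 ⋯ p_{n-1}`. -/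
theorem gamma_card_of_nearly_trivial (n : ℕ) (hn : 3 ≤ n) (p : ℕ → ℕ)
    (hp : ∀ k : ℕ, 1 ≤ k → k ≤ n - 1 → 2 ≤ p k)
    (hadm : Admissible n p)
    (hcond : ∀ k : ℕ, 1 < k → k < n - 1 → p k = 2 ∨ (p (k - 1) = 2 ∧ p (k + 1) = 2)) :
    (∀ i j : Fin n, (i : ℕ) + 1 = (j : ℕ) → orderOf (xg n p i * xg n p j) = p (j : ℕ)) ∧
    Nat.card (Gamma n p) = 2 * ∏ k ∈ Finset.Icc 1 (n - 1), p k := by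
  rcases hn.eq_or_lt with rfl | hn4
  · have hprod : ∏ k ∈ Finset.Icc 1 (3 - 1), p k = p 1 * p 2 :=
      Finset.prod_Icc_succ_top (by norm_num) p |>.trans (by simp)
    have hp1 : 0 < p 1 := two_pos.trans_le (hp 1 le_rfl (by norm_num))
    have hp2 : 0 < p 2 := two_pos.trans_le (hp 2 (by norm_num) le_rfl)
    rw [hprod]
    rcases Nat.even_or_odd (p 1) with h1 | h1
    · rcases Nat.even_or_odd (p 2) with h2 | h2
      · exact gamma_three_of_even_even hp1 hp2 h1 h2
      · exact gamma_three_of_even_odd hp1 h1 h2 ((hadm 2 (by norm_num) le_rfl h2).1 le_rfl).2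
    · obtain ⟨h2, hdvd⟩ := (hadm 1 le_rfl (by norm_num) h1).2 le_rfl
      exact gamma_three_of_odd_even hp2 h1 h2 hdvd
  · refine gamma_of_adjacent_eq_two (by omega) hp fun k hk hkn => ?_
    by_cases h : k = 1
    · exact (hcond (k + 1) (by omega) (by omega)).symm.imp_left And.left
    · exact (hcond k (by omega) (by omega)).imp_right And.right
end

section
/- Let n ≥ 3 and let (p_1, …, p_{n−1}) be an admissible tuple of integers, each at least 2. For 1 ≤ i ≤ n−1, let q_i denote the order of x_{i−1} x_i in Γ(p_1, …, p_{n−1}). Then q_i = p_i whenever p_i is odd, and the order of Γ(p_1, …, p_{n−1}) equals 2 q_1 q_2 ⋯ q_{n−1}; in particular, the order of Γ(p_1, …, p_{n−1}) divides 2 p_1 p_2 ⋯ p_{n−1}. -/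
/-- The condition imposed by the relator `r_i` on consecutive involutions `x, y, z`, where `a`
and `b` are the exponents of `x * y` and `y * z`. -/
structure TriRel {G : Type*} [Group G] (a b : ℕ) (x y z : G) : Prop where
  even_even : Even a → Even b → (x * y * z * y) ^ 2 = 1
  odd_even : Odd a → Even b → (x * y * z * y * z) ^ 2 = 1
  even_odd : Even a → Odd b → (z * y * x * y * x) ^ 2 = 1

/-- The sequence `f 0, …, f (n - 1)` satisfies the defining relations of `Gamma n p`. -/
structure IsGammaRep {G : Type*} [Group G] (n : ℕ) (p : ℕ → ℕ) (f : ℕ → G) : Prop where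
  sq : ∀ i < n, f i * f i = 1
  edge : ∀ i, i + 1 < n → (f i * f (i + 1)) ^ p (i + 1) = 1
  far : ∀ i j, i + 2 ≤ j → j < n → (f i * f j) ^ 2 = 1
  tri : ∀ i, i + 2 < n → TriRel (p (i + 1)) (p (i + 2)) (f i) (f (i + 1)) (f (i + 2))

section TriRel

variable {G : Type*} [Group G] {a b : ℕ} {x y z : G}

theorem mul_comm_of_sq_eq_one (hx : x * x = 1) (hy : y * y = 1) (h : (x * y) ^ 2 = 1) :
    x * y = y * x := by
  have h2 : x * y = (x * y)⁻¹ := by rw [eq_inv_iff_mul_eq_one, ← sq, h]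
  rw [h2, mul_inv_rev, inv_eq_of_mul_eq_one_right hx, inv_eq_of_mul_eq_one_right hy]

theorem pow_eq_one_of_even {k : ℕ} (hx : x * x = 1) (hk : Even k) : x ^ k = 1 := by
  obtain ⟨r, rfl⟩ := hk
  rw [← two_mul, pow_mul, sq, hx, one_pow]

theorem TriRel.symm (hy : y * y = 1) (h : TriRel a b x y z) : TriRel b a z y x where
  even_even hb ha := by
    have h1 := h.even_even ha hb
    have hy' : y⁻¹ = y := inv_eq_of_mul_eq_one_right hy
    have h2 : z * y * x * y = (x * y)⁻¹ * (x * y * z * y) * (x * y) := by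
      rw [mul_inv_rev, hy']; simp only [mul_assoc, inv_mul_cancel_left]
      rw [← mul_assoc y y, hy, one_mul]
    have h3 := conj_pow (i := 2) (a := (x * y)⁻¹) (b := x * y * z * y)
    rw [inv_inv, ← h2, h1] at h3
    simpa using h3
  odd_even hb ha := h.even_odd ha hb
  even_odd hb ha := h.odd_even ha hb

theorem TriRel.one_right (hb : Even b) (hx : x * x = 1) (hy : y * y = 1) :
    TriRel a b x y 1 where
  even_even _ _ := by simp [mul_assoc, hy, sq, hx]
  odd_even _ _ := by simp [mul_assoc, hy, sq, hx]
  even_odd _ h := absurd hb (Nat.not_even_iff_odd.mpr h)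

theorem TriRel.one_left (ha : Even a) (hy : y * y = 1) (hz : z * z = 1) :
    TriRel a b 1 y z :=
  (TriRel.one_right ha hz hy).symm hy

/-- The square of a product of two consecutive involutions is centralised or inverted by the
preceding involution. -/
theorem TriRel.conj_left (hx : x * x = 1) (hy : y * y = 1) (hz : z * z = 1)
    (hxz : (x * z) ^ 2 = 1) (hb : Even b) (h : TriRel a b x y z) :
    x * (y * z) ^ 2 * x⁻¹ = (y * z) ^ 2 ∨ x * (y * z) ^ 2 * x⁻¹ = ((y * z) ^ 2)⁻¹ := by
  rcases Nat.even_or_odd a with ha | ha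
  · left
    have h1 := h.even_even ha hb
    have hyzy : (y * z * y) * (y * z * y) = 1 := by
      calc _ = y * (z * ((y * y) * z)) * y := by group
        _ = 1 := by rw [hy, one_mul, hz, mul_one, hy]
    have c1 : Commute x (y * z * y) := mul_comm_of_sq_eq_one hx hyzy (by simpa [mul_assoc] using h1)
    have c2 : Commute x z := mul_comm_of_sq_eq_one hx hz hxz
    have c3 : Commute x ((y * z) ^ 2) := by
      have : (y * z) ^ 2 = y * z * y * z := by rw [sq]; group
      rw [this]; exact c1.mul_right c2
    rw [c3.eq, mul_inv_cancel_right]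
  · right
    have h1 := h.odd_even ha hb
    rw [eq_inv_iff_mul_eq_one, inv_eq_of_mul_eq_one_right hx, ← h1]
    simp only [sq, mul_assoc]

theorem conj_sq_left (hx : x * x = 1) (hy : y * y = 1) :
    x * (x * y) ^ 2 * x⁻¹ = ((x * y) ^ 2)⁻¹ := by
  have hx' := inv_eq_of_mul_eq_one_right hx
  have hy' := inv_eq_of_mul_eq_one_right hy
  rw [← inv_pow, mul_inv_rev, hy', hx', sq, sq]
  calc _ = (x * x) * y * x * y * x := by group
    _ = _ := by rw [hx]; group

end TriRel

namespace IsGammaRep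

variable {G H : Type*} [Group G] [Group H] {n m : ℕ} {p : ℕ → ℕ} {f : ℕ → G} {g : ℕ → H}

theorem map (hf : IsGammaRep n p f) (φ : G →* H) : IsGammaRep n p (fun i => φ (f i)) where
  sq i hi := by rw [← map_mul, hf.sq i hi, map_one]
  edge i hi := by rw [← map_mul, ← map_pow, hf.edge i hi, map_one]
  far i j hij hj := by rw [← map_mul, ← map_pow, hf.far i j hij hj, map_one]
  tri i hi := by
    refine ⟨fun h1 h2 => ?_, fun h1 h2 => ?_, fun h1 h2 => ?_⟩ <;>
      simp only [← map_mul, ← map_pow]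
    · rw [(hf.tri i hi).even_even h1 h2, map_one]
    · rw [(hf.tri i hi).odd_even h1 h2, map_one]
    · rw [(hf.tri i hi).even_odd h1 h2, map_one]

theorem prod (hf : IsGammaRep n p f) (hg : IsGammaRep n p g) :
    IsGammaRep n p (fun i => (f i, g i)) where
  sq i hi := Prod.ext (hf.sq i hi) (hg.sq i hi)
  edge i hi := Prod.ext (hf.edge i hi) (hg.edge i hi)
  far i j hij hj := Prod.ext (hf.far i j hij hj) (hg.far i j hij hj)
  tri i hi :=
    ⟨fun h1 h2 => Prod.ext ((hf.tri i hi).even_even h1 h2) ((hg.tri i hi).even_even h1 h2),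
      fun h1 h2 => Prod.ext ((hf.tri i hi).odd_even h1 h2) ((hg.tri i hi).odd_even h1 h2),
      fun h1 h2 => Prod.ext ((hf.tri i hi).even_odd h1 h2) ((hg.tri i hi).even_odd h1 h2)⟩

theorem restrict (hf : IsGammaRep n p f) (h : m ≤ n) : IsGammaRep m p f :=
  ⟨fun i hi => hf.sq i (by omega), fun i hi => hf.edge i (by omega),
    fun i j hij hj => hf.far i j hij (by omega), fun i hi => hf.tri i (by omega)⟩

theorem shift {i : ℕ} (hf : IsGammaRep (i + m) p f) :
    IsGammaRep m (fun k => p (i + k)) (fun k => f (i + k)) :=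
  ⟨fun k hk => hf.sq (i + k) (by omega), fun k hk => hf.edge (i + k) (by omega),
    fun k l hkl hl => hf.far (i + k) (i + l) (by omega) (by omega),
    fun k hk => hf.tri (i + k) (by omega)⟩

theorem extend_right {i : ℕ} (hp : Even (p i)) (hf : IsGammaRep i p f) :
    IsGammaRep n p (fun k => if k < i then f k else 1) where
  sq k _ := by
    split_ifs with h
    · exact hf.sq k h
    · simp
  edge k _ := by
    rcases lt_trichotomy (k + 1) i with h | h | h
    · rw [if_pos (by omega), if_pos h]; exact hf.edge k h
    · rw [if_pos (by omega), if_neg (by omega), h, mul_one]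
      exact pow_eq_one_of_even (hf.sq k (by omega)) hp
    · rw [if_neg (by omega), if_neg (by omega)]; simp
  far k l hkl _ := by
    split_ifs with h1 h2 h2
    · exact hf.far k l hkl h2
    · rw [mul_one, _root_.sq, hf.sq k h1]
    · omega
    · simp
  tri k _ := by
    rcases lt_trichotomy (k + 2) i with h | h | h
    · rw [if_pos (by omega), if_pos (by omega), if_pos h]; exact hf.tri k h
    · rw [if_pos (by omega), if_pos (by omega), if_neg (by omega)]
      exact .one_right (h ▸ hp) (hf.sq k (by omega)) (hf.sq _ (by omega))
    · rw [if_neg (show ¬ k + 1 < i by omega), if_neg (show ¬ k + 2 < i by omega)]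
      split_ifs with h1
      · obtain rfl : i = k + 1 := by omega
        have := hf.sq k h1
        exact ⟨by simp [_root_.sq, this], by simp [_root_.sq, this], by simp [this]⟩
      · exact ⟨by simp, by simp, by simp⟩

theorem extend_left {i : ℕ} (hp : Even (p i)) (hf : IsGammaRep m (fun k => p (i + k)) f) :
    IsGammaRep (i + m) p (fun k => if k < i then 1 else f (k - i)) where
  sq k _ := by
    split_ifs with h
    · simp
    · exact hf.sq (k - i) (by omega)
  edge k _ := by
    rcases lt_trichotomy (k + 1) i with h | h | h
    · rw [if_pos (by omega), if_pos h]; simp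
    · rw [if_pos (by omega), if_neg (by omega), h, one_mul]
      exact pow_eq_one_of_even (hf.sq (i - i) (by omega)) hp
    · rw [if_neg (by omega), if_neg (by omega)]
      have := hf.edge (k - i) (by omega)
      rwa [show i + (k - i + 1) = k + 1 by omega, show k - i + 1 = k + 1 - i by omega] at this
  far k l hkl _ := by
    split_ifs with h1 h2 h2
    · simp
    · rw [one_mul, _root_.sq, hf.sq (l - i) (by omega)]
    · omega
    · exact hf.far (k - i) (l - i) (by omega) (by omega)
  tri k _ := by
    rcases lt_or_ge k i with h | h
    · rw [if_pos h]
      rcases lt_trichotomy (k + 1) i with h1 | h1 | h1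
      · rw [if_pos h1]
        split_ifs with h2
        · exact ⟨by simp, by simp, by simp⟩
        · obtain rfl : i = k + 2 := by omega
          have : f 0 * f 0 = 1 := hf.sq 0 (by omega)
          exact ⟨by simp [_root_.sq, this], by simp [this], by simp [_root_.sq, this]⟩
      · rw [if_neg (by omega), if_neg (by omega)]
        exact .one_left (h1 ▸ hp) (hf.sq _ (by omega)) (hf.sq _ (by omega))
      · omega
    · rw [if_neg (by omega), if_neg (by omega), if_neg (by omega)]
      have := hf.tri (k - i) (by omega)
      rwa [show i + (k - i + 1) = k + 1 by omega, show i + (k - i + 2) = k + 2 by omega,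
        show k - i + 1 = k + 1 - i by omega, show k - i + 2 = k + 2 - i by omega] at this

end IsGammaRep

namespace Gamma

/-- The generators of `Gamma n p`, extended by `1` to all natural indices. -/
def gen (n : ℕ) (p : ℕ → ℕ) (i : ℕ) : Gamma n p := if h : i < n then xg n p ⟨i, h⟩ else 1

variable {G : Type*} [Group G] {n : ℕ} {p : ℕ → ℕ} {f : ℕ → G}

theorem gen_fin (i : Fin n) : gen n p i = PresentedGroup.of i := by
  simp [gen, xg]

theorem isGammaRep_gen (n : ℕ) (p : ℕ → ℕ) : IsGammaRep n p (gen n p) := by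
  have key : ∀ w ∈ gammaRels n p, PresentedGroup.mk (gammaRels n p) w = 1 :=
    fun w hw => PresentedGroup.one_of_mem hw
  have e : ∀ i : Fin n, PresentedGroup.mk (gammaRels n p) (FreeGroup.of i) = gen n p i :=
    fun i => (gen_fin i).symm
  refine ⟨fun i hi => ?_, fun i hi => ?_, fun i j hij hj => ?_, fun i hi => ⟨?_, ?_, ?_⟩⟩
  · have := key _ (.inl ⟨⟨i, hi⟩, rfl⟩)
    rwa [map_pow, e, sq] at this
  · have := key _ (.inr <| .inl ⟨⟨i, by omega⟩, ⟨i + 1, hi⟩, rfl, rfl⟩)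
    rwa [map_pow, map_mul, e, e] at this
  · have := key _ (.inr <| .inr <| .inl ⟨⟨i, by omega⟩, ⟨j, hj⟩, hij, rfl⟩)
    rwa [map_pow, map_mul, e, e] at this
  all_goals intro h1 h2
  · have := key _ (.inr <| .inr <| .inr ⟨⟨i, by omega⟩, ⟨i + 1, by omega⟩, ⟨i + 2, hi⟩, rfl, rfl,
      .inl ⟨h1, h2, rfl⟩⟩)
    simpa only [map_pow, map_mul, e] using this
  · have := key _ (.inr <| .inr <| .inr ⟨⟨i, by omega⟩, ⟨i + 1, by omega⟩, ⟨i + 2, hi⟩, rfl, rfl,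
      .inr <| .inl ⟨h1, h2, rfl⟩⟩)
    simpa only [map_pow, map_mul, e] using this
  · have := key _ (.inr <| .inr <| .inr ⟨⟨i, by omega⟩, ⟨i + 1, by omega⟩, ⟨i + 2, hi⟩, rfl, rfl,
      .inr <| .inr ⟨h1, h2, rfl⟩⟩)
    simpa only [map_pow, map_mul, e] using this

theorem lift_rel (hf : IsGammaRep n p f) :
    ∀ r ∈ gammaRels n p, FreeGroup.lift (fun i : Fin n => f i) r = 1 := by
  rintro r (⟨i, rfl⟩ | ⟨⟨i, hi⟩, ⟨j, hj⟩, hij, rfl⟩ | ⟨i, j, hij, rfl⟩ |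
    ⟨⟨a, ha⟩, ⟨b, hb⟩, ⟨c, hc⟩, hab, hbc, h⟩)
  · simpa [sq] using hf.sq i i.2
  · dsimp only at hij; subst hij
    simpa using hf.edge i hj
  · simpa using hf.far i j hij j.2
  · dsimp only at hab hbc h
    subst hbc; subst hab
    have := hf.tri a hc
    rcases h with ⟨h1, h2, rfl⟩ | ⟨h1, h2, rfl⟩ | ⟨h1, h2, rfl⟩
    · simpa using this.even_even h1 h2
    · simpa using this.odd_even h1 h2
    · simpa using this.even_odd h1 h2

/-- The homomorphism out of `Gamma n p` given by images of the generators. -/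
def lift (hf : IsGammaRep n p f) : Gamma n p →* G := PresentedGroup.toGroup (lift_rel hf)

theorem lift_gen (hf : IsGammaRep n p f) {i : ℕ} (hi : i < n) : lift hf (gen n p i) = f i := by
  rw [show i = ((⟨i, hi⟩ : Fin n) : ℕ) from rfl, gen_fin]
  exact PresentedGroup.toGroup.of _

theorem hom_ext {φ ψ : Gamma n p →* G} (h : ∀ i < n, φ (gen n p i) = ψ (gen n p i)) : φ = ψ :=
  PresentedGroup.ext fun i => by simpa [gen_fin] using h i i.2

theorem mem_of_gen (S : Subgroup (Gamma n p)) (h : ∀ i < n, gen n p i ∈ S) (g : Gamma n p) :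
    g ∈ S :=
  PresentedGroup.generated_by _ S (fun i => by simpa [gen_fin] using h i i.2) g

end Gamma

/-- The sequence `1, …, 1, a, b, c, d, 1, …` placed so that `b * c` is the edge `i`. -/
def fourSeq {G : Type*} [Group G] (i : ℕ) (a b c d : G) (j : ℕ) : G :=
  if j + 2 = i then a else if j + 1 = i then b else if j = i then c else if j = i + 1 then d else 1

/-- Conditions on `a, b, c, d` under which `fourSeq i a b c d` satisfies the relations. -/
theorem isGammaRep_fourSeq {G : Type*} [Group G] {n : ℕ} {p : ℕ → ℕ} (hadm : Admissible n p)
    {i : ℕ} (hi : 1 ≤ i) (hin : i < n) {a b c d : G} (ha : a * a = 1) (hb : b * b = 1)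
    (hc : c * c = 1) (hd : d * d = 1) (hac : (a * c) ^ 2 = 1) (hbd : (b * d) ^ 2 = 1)
    (had : (a * d) ^ 2 = 1) (hbc : (b * c) ^ p i = 1)
    (hab : 2 ≤ i → (a * b) ^ p (i - 1) = 1) (hcd : i + 1 < n → (c * d) ^ p (i + 1) = 1)
    (ha1 : a = 1 ∨ Odd (p (i - 1))) (hd1 : d = 1 ∨ Odd (p (i + 1)))
    (habc : 2 ≤ i → TriRel (p (i - 1)) (p i) a b c)
    (hbcd : i + 1 < n → TriRel (p i) (p (i + 1)) b c d) :
    IsGammaRep n p (fourSeq i a b c d) := by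
  set s := fourSeq i a b c d with hs
  have vout : ∀ {j}, j + 2 < i ∨ i + 1 < j → s j = 1 := fun {j} h => by
    rw [hs, fourSeq, if_neg (by omega), if_neg (by omega), if_neg (by omega), if_neg (by omega)]
  have va : ∀ {j}, j + 2 = i → s j = a := fun {j} h => by rw [hs, fourSeq, if_pos h]
  have vb : ∀ {j}, j + 1 = i → s j = b := fun {j} h => by
    rw [hs, fourSeq, if_neg (by omega), if_pos h]
  have vc : ∀ {j}, j = i → s j = c := fun {j} h => by
    rw [hs, fourSeq, if_neg (by omega), if_neg (by omega), if_pos h]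
  have vd : ∀ {j}, j = i + 1 → s j = d := fun {j} h => by
    rw [hs, fourSeq, if_neg (by omega), if_neg (by omega), if_neg (by omega), if_pos h]
  have hsq : ∀ j, s j * s j = 1 := fun j => by
    rw [hs, fourSeq]; split_ifs <;> first | assumption | exact one_mul 1
  have one_pow_of_sq : ∀ {x : G}, x * x = 1 → (1 * x) ^ 2 = 1 := fun hx => by rw [one_mul, sq, hx]
  have pow_one_of_sq : ∀ {x : G}, x * x = 1 → (x * 1) ^ 2 = 1 := fun hx => by rw [mul_one, sq, hx]
  have tri_three : ∀ {x : G} {k l : ℕ}, x * x = 1 → TriRel k l 1 1 x := fun hx =>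
    ⟨by simp [sq, hx], by simp [hx], by simp [sq, hx]⟩
  refine ⟨fun j _ => hsq j, fun j hj => ?_, fun j k hjk hk => ?_, fun j hj => ?_⟩
  · obtain h | h | rfl | rfl | rfl | rfl | h : j + 3 < i ∨ j + 3 = i ∨ i = j + 2 ∨ i = j + 1 ∨
        j = i ∨ j = i + 1 ∨ i + 1 < j := by omega
    · rw [vout (by omega), vout (by omega), one_mul, one_pow]
    · rw [vout (by omega), va (by omega), one_mul]
      rcases ha1 with rfl | ho
      · exact one_pow _
      · subst h
        exact pow_eq_one_of_even ha ((hadm _ (by omega) (by omega) ho).1 (by omega)).1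
    · rw [va rfl, vb rfl]; exact hab (by omega)
    · rw [vb rfl, vc rfl]; exact hbc
    · rw [vc rfl, vd rfl]; exact hcd hj
    · rw [vd rfl, vout (by omega), mul_one]
      rcases hd1 with rfl | ho
      · exact one_pow _
      · exact pow_eq_one_of_even hd ((hadm _ (by omega) (by omega) ho).2 (by omega)).1
    · rw [vout (by omega), vout (by omega), one_mul, one_pow]
  · by_cases h1 : j + 2 < i ∨ i + 1 < j
    · rw [vout h1]; exact one_pow_of_sq (hsq k)
    by_cases h2 : i + 1 < k
    · rw [vout (.inr h2)]; exact pow_one_of_sq (hsq j)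
    obtain ⟨h3, h4⟩ | ⟨h3, h4⟩ | ⟨h3, h4⟩ : (j + 2 = i ∧ k = i) ∨ (j + 2 = i ∧ k = i + 1) ∨
        (j + 1 = i ∧ k = i + 1) := by omega
    · rw [va h3, vc h4]; exact hac
    · rw [va h3, vd h4]; exact had
    · rw [vb h3, vd h4]; exact hbd
  · obtain h | h | h | rfl | rfl | rfl | rfl | h : j + 4 < i ∨ j + 4 = i ∨ j + 3 = i ∨ i = j + 2 ∨
        i = j + 1 ∨ j = i ∨ j = i + 1 ∨ i + 1 < j := by omega
    · rw [vout (by omega), vout (by omega), vout (by omega)]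
      exact tri_three (one_mul 1)
    · rw [vout (by omega), vout (by omega), va (by omega)]
      exact tri_three ha
    · rw [vout (by omega), va (by omega), vb (by omega)]
      subst h
      rcases ha1 with rfl | ho
      · exact tri_three hb
      · exact .one_left ((hadm _ (by omega) (by omega) ho).1 (by omega)).1 ha hb
    · rw [va rfl, vb rfl, vc rfl]; exact habc (by omega)
    · rw [vb rfl, vc rfl, vd rfl]; exact hbcd hj
    · rw [vc rfl, vd rfl, vout (by omega)]
      rcases hd1 with rfl | ho
      · exact (tri_three hc).symm (one_mul 1)
      · exact .one_right ((hadm _ (by omega) (by omega) ho).2 (by omega)).1 hc hd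
    · rw [vd rfl, vout (by omega), vout (by omega)]
      exact (tri_three hd).symm (one_mul 1)
    · rw [vout (by omega), vout (by omega), vout (by omega)]
      exact tri_three (one_mul 1)

namespace Gamma
variable {n : ℕ} {p : ℕ → ℕ}

theorem commute_gen {i j : ℕ} (hij : i + 2 ≤ j) (hj : j < n) :
    Commute (gen n p i) (gen n p j) :=
  have h := isGammaRep_gen n p
  mul_comm_of_sq_eq_one (h.sq i (by omega)) (h.sq j hj) (h.far i j hij hj)

theorem conj_edge_sq {i : ℕ} (hi : i + 1 < n) (hp : Even (p (i + 1))) (g : Gamma n p) :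
    g * (gen n p i * gen n p (i + 1)) ^ 2 * g⁻¹ = (gen n p i * gen n p (i + 1)) ^ 2 ∨
    g * (gen n p i * gen n p (i + 1)) ^ 2 * g⁻¹ = ((gen n p i * gen n p (i + 1)) ^ 2)⁻¹ := by
  have h := isGammaRep_gen n p
  have hi2 := h.sq i (by omega)
  have hi2' := h.sq (i + 1) hi
  have hinv : (gen n p (i + 1) * gen n p i) ^ 2 = ((gen n p i * gen n p (i + 1)) ^ 2)⁻¹ := by
    rw [← inv_pow, mul_inv_rev, inv_eq_of_mul_eq_one_right hi2, inv_eq_of_mul_eq_one_right hi2']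
  set w := (gen n p i * gen n p (i + 1)) ^ 2 with hw
  have flip : ∀ x : Gamma n p, (x * w⁻¹ * x⁻¹ = w⁻¹ ∨ x * w⁻¹ * x⁻¹ = w⁻¹⁻¹) →
      (x * w * x⁻¹ = w ∨ x * w * x⁻¹ = w⁻¹) := by
    intro x hx
    rw [← conj_inv, inv_inj, inv_inj] at hx
    exact hx
  let S : Subgroup (Gamma n p) :=
    { carrier := {x | x * w * x⁻¹ = w ∨ x * w * x⁻¹ = w⁻¹}
      one_mem' := by simp
      mul_mem' := by
        rintro x y hx hy
        have e : x * y * w * (x * y)⁻¹ = x * (y * w * y⁻¹) * x⁻¹ := by group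
        simp only [Set.mem_ofPred_eq] at hx hy ⊢
        rw [e]
        rcases hy with hy | hy <;> rw [hy]
        · exact hx
        · rw [← conj_inv, inv_inj, or_comm, inv_eq_iff_eq_inv]; exact hx
      inv_mem' := by
        rintro x hx
        have e : x⁻¹ * (x * w * x⁻¹) * x⁻¹⁻¹ = w := by group
        rcases hx with hx | hx <;> rw [hx] at e
        · exact .inl e
        · exact .inr (by rwa [← conj_inv, inv_eq_iff_eq_inv] at e) }
  refine mem_of_gen S (fun j hj => ?_) g
  rcases lt_trichotomy (j + 1) i with hji | hji | hji
  · left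
    have c1 : Commute (gen n p j) w :=
      ((commute_gen (by omega) (by omega)).mul_right (commute_gen (by omega) hi)).pow_right 2
    rw [c1.eq, mul_inv_cancel_right]
  · subst hji
    exact (h.tri j hi).conj_left (h.sq j hj) hi2 hi2' (h.far _ _ le_rfl hi) hp
  · rcases Nat.lt_or_ge (i + 2) j with hij | hij
    · left
      have c1 : Commute (gen n p j) w :=
        ((commute_gen (by omega) hj).symm.mul_right (commute_gen (by omega) hj).symm).pow_right 2
      rw [c1.eq, mul_inv_cancel_right]
    · obtain rfl | rfl | rfl : j = i ∨ j = i + 1 ∨ j = i + 2 := by omega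
      · exact .inr (conj_sq_left hi2 hi2')
      · have := conj_sq_left hi2' hi2
        exact flip _ (.inr (by rw [← hinv]; exact this))
      · refine flip _ ?_
        rw [← hinv]
        refine ((h.tri i hj).symm hi2').conj_left (h.sq _ hj) hi2' hi2 ?_ hp
        have := commute_gen (p := p) (le_refl (i + 2)) hj
        rw [← this.eq]; exact h.far _ _ le_rfl hj

theorem normal_zpowers_edge_sq {i : ℕ} (hi : i + 1 < n) (hp : Even (p (i + 1))) :
    (Subgroup.zpowers ((gen n p i * gen n p (i + 1)) ^ 2)).Normal := by
  refine ⟨?_⟩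
  rintro _ ⟨k, rfl⟩ g
  dsimp only
  rw [← conj_zpow]
  rcases conj_edge_sq hi hp g with h | h <;> rw [h]
  · exact ⟨k, rfl⟩
  · exact ⟨-k, by simp⟩

/-- At an edge of even exponent, `Gamma` splits modulo the square of the corresponding rotation. -/
theorem card_split {i m : ℕ} (hm : 1 ≤ m) (hp : Even (p (i + 1))) :
    Nat.card (Gamma (i + 1 + m) p) =
      Nat.card (Gamma (i + 1) p) * Nat.card (Gamma m fun k => p (i + 1 + k)) *
      orderOf ((gen (i + 1 + m) p i * gen (i + 1 + m) p (i + 1)) ^ 2) := by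
  set n := i + 1 + m
  set w := (gen n p i * gen n p (i + 1)) ^ 2 with hw
  have := normal_zpowers_edge_sq (n := n) (p := p) (i := i) (by omega) hp
  rw [← hw] at this
  set N := Subgroup.zpowers w
  have hrep := (isGammaRep_gen n p).map (QuotientGroup.mk' N)
  have hcomm : ∀ j k, j < i + 1 → k < m →
      Commute (QuotientGroup.mk' N (gen n p j)) (QuotientGroup.mk' N (gen n p (i + 1 + k))) := by
    intro j k hj hk
    refine mul_comm_of_sq_eq_one (hrep.sq j (by omega)) (hrep.sq _ (by omega)) ?_
    by_cases h : j = i ∧ k = 0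
    · obtain ⟨rfl, rfl⟩ := h
      rw [← map_mul, ← map_pow]
      exact (QuotientGroup.eq_one_iff _).mpr (Subgroup.mem_zpowers w)
    · exact hrep.far _ _ (by omega) (by omega)
  let φ : Gamma (i + 1) p →* Gamma n p ⧸ N := lift (hrep.restrict (by omega))
  let ψ : Gamma m (fun k => p (i + 1 + k)) →* Gamma n p ⧸ N := lift hrep.shift
  have hφ : ∀ j < i + 1, φ (gen _ _ j) = QuotientGroup.mk' N (gen n p j) :=
    fun j hj => lift_gen _ hj
  have hψ : ∀ j < m, ψ (gen _ _ j) = QuotientGroup.mk' N (gen n p (i + 1 + j)) :=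
    fun j hj => lift_gen (f := fun k => QuotientGroup.mk' N (gen n p (i + 1 + k))) _ hj
  have hc : ∀ x y, Commute (φ x) (ψ y) := by
    intro x y
    have h1 : ∀ j < i + 1, Commute (φ (gen _ _ j)) (ψ y) := fun j hj => by
      have := mem_of_gen ((Subgroup.centralizer {φ (gen _ _ j)}).comap ψ) (fun k hk => by
        rw [Subgroup.mem_comap, Subgroup.mem_centralizer_singleton_iff, hφ j hj, hψ k hk]
        exact (hcomm j k hj hk).symm.eq) y
      rw [Subgroup.mem_comap, Subgroup.mem_centralizer_singleton_iff] at this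
      exact this.symm
    have := mem_of_gen ((Subgroup.centralizer {ψ y}).comap φ) (fun k hk => by
      rw [Subgroup.mem_comap, Subgroup.mem_centralizer_singleton_iff]
      exact (h1 k hk).eq) x
    rw [Subgroup.mem_comap, Subgroup.mem_centralizer_singleton_iff] at this
    exact this
  let Ψ := φ.noncommCoprod ψ hc
  let Φ : Gamma n p →* Gamma (i + 1) p × Gamma m (fun k => p (i + 1 + k)) :=
    lift (((isGammaRep_gen (i + 1) p).extend_right hp).prod
      ((isGammaRep_gen m fun k => p (i + 1 + k)).extend_left hp))
  have hΦ : ∀ j < n, Φ (gen n p j) = (if j < i + 1 then gen _ _ j else 1,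
    if j < i + 1 then 1 else gen _ _ (j - (i + 1))) := fun j hj => lift_gen _ hj
  have hker : N ≤ Φ.ker := by
    rw [Subgroup.zpowers_le, MonoidHom.mem_ker, hw, map_pow, map_mul, hΦ i (by omega),
      hΦ (i + 1) (by omega)]
    have h1 := (isGammaRep_gen (i + 1) p).sq i (by omega)
    have h2 := (isGammaRep_gen m fun k => p (i + 1 + k)).sq 0 (by omega)
    simp [Prod.ext_iff, sq, h1, h2]
  let Φ' := QuotientGroup.lift N Φ hker
  have h1 : Ψ.comp Φ' = MonoidHom.id _ := by
    refine QuotientGroup.monoidHom_ext _ (hom_ext fun j hj => ?_)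
    change Ψ (Φ (gen n p j)) = QuotientGroup.mk' N (gen n p j)
    rw [hΦ j hj]
    simp only [Ψ, MonoidHom.noncommCoprod_apply]
    split_ifs with h
    · rw [hφ j h, map_one, mul_one]
    · rw [map_one, one_mul, hψ _ (by omega), show i + 1 + (j - (i + 1)) = j by omega]
  have h2 : Φ'.comp Ψ = MonoidHom.id _ := by
    have e1 : Φ'.comp φ = MonoidHom.inl _ _ := hom_ext fun j hj => by
      have : Φ' (φ (gen _ _ j)) = Φ (gen n p j) := by rw [hφ j hj]; rfl
      simp [this, hΦ j (by omega), hj]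
    have e2 : Φ'.comp ψ = MonoidHom.inr _ _ := hom_ext fun j hj => by
      have : Φ' (ψ (gen _ _ j)) = Φ (gen n p (i + 1 + j)) := by rw [hψ j hj]; rfl
      simp [this, hΦ (i + 1 + j) (by omega), show ¬ i + 1 + j ≤ i by omega]
    refine MonoidHom.ext fun ⟨x, y⟩ => ?_
    have := congrArg₂ (· * ·) (DFunLike.congr_fun e1 x) (DFunLike.congr_fun e2 y)
    simpa [Ψ] using this
  have hcard := Nat.card_congr (MonoidHom.toMulEquiv Φ' Ψ h1 h2).toEquiv
  rw [Subgroup.card_eq_card_quotient_mul_card_subgroup N, hcard, Nat.card_prod, Nat.card_zpowers]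

end Gamma

section Models

variable (R : Type*) [CommRing R]

/-- The reflection `x ↦ -x` of the first coordinate. -/
def reflA : Equiv.Perm (R × R × R) :=
  Function.Involutive.toPerm (fun v => (-v.1, v.2.1, v.2.2)) fun v => by simp

/-- The composite of `reflA` with the transvection `x ↦ x + y`. -/
def reflB : Equiv.Perm (R × R × R) :=
  Function.Involutive.toPerm (fun v => (-v.1 - v.2.1, v.2.1, v.2.2)) fun v => by simp

/-- The composite of `reflD` with the transvection `y ↦ y + z`. -/
def reflC : Equiv.Perm (R × R × R) :=
  Function.Involutive.toPerm (fun v => (v.1, v.2.1 - v.2.2, -v.2.2)) fun v => by simp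

/-- The reflection `z ↦ -z` of the last coordinate. -/
def reflD : Equiv.Perm (R × R × R) :=
  Function.Involutive.toPerm (fun v => (v.1, v.2.1, -v.2.2)) fun v => by simp

theorem reflA_apply (v : R × R × R) : reflA R v = (-v.1, v.2.1, v.2.2) := rfl
theorem reflB_apply (v : R × R × R) : reflB R v = (-v.1 - v.2.1, v.2.1, v.2.2) := rfl
theorem reflC_apply (v : R × R × R) : reflC R v = (v.1, v.2.1 - v.2.2, -v.2.2) := rfl
theorem reflD_apply (v : R × R × R) : reflD R v = (v.1, v.2.1, -v.2.2) := rfl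

theorem reflA_mul_reflB_pow (k : ℕ) (v : R × R × R) :
    ((reflA R * reflB R) ^ k) v = (v.1 + k * v.2.1, v.2.1, v.2.2) := by
  induction k with
  | zero => simp
  | succ k ih =>
    rw [pow_succ', Equiv.Perm.mul_apply, ih]
    ext <;> simp [reflA_apply, reflB_apply]
    ring

theorem reflC_mul_reflD_pow (k : ℕ) (v : R × R × R) :
    ((reflC R * reflD R) ^ k) v = (v.1, v.2.1 + k * v.2.2, v.2.2) := by
  induction k with
  | zero => simp
  | succ k ih =>
    rw [pow_succ', Equiv.Perm.mul_apply, ih]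
    ext <;> simp [reflC_apply, reflD_apply]
    ring

theorem reflB_mul_reflC_sq_pow (k : ℕ) (v : R × R × R) :
    (((reflB R * reflC R) ^ 2) ^ k) v = (v.1 - k * v.2.2, v.2.1, v.2.2) := by
  induction k with
  | zero => simp
  | succ k ih =>
    rw [pow_succ', Equiv.Perm.mul_apply, ih, sq]
    ext <;> simp [reflB_apply, reflC_apply]
    ring

theorem refl_relations :
    (reflA R * reflA R = 1 ∧ reflB R * reflB R = 1 ∧ reflC R * reflC R = 1 ∧
      reflD R * reflD R = 1) ∧
    ((reflA R * reflC R) ^ 2 = 1 ∧ (reflB R * reflD R) ^ 2 = 1 ∧ (reflA R * reflD R) ^ 2 = 1) ∧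
    (reflA R * reflB R * reflC R * reflB R * reflC R) ^ 2 = 1 ∧
    (reflD R * reflC R * reflB R * reflC R * reflB R) ^ 2 = 1 := by
  refine ⟨⟨?_, ?_, ?_, ?_⟩, ⟨?_, ?_, ?_⟩, ?_, ?_⟩ <;>
  · ext v <;> simp [sq, reflA_apply, reflB_apply, reflC_apply, reflD_apply] <;> ring

theorem orderOf_reflB_mul_reflC_sq (m : ℕ) :
    orderOf ((reflB (ZMod m) * reflC (ZMod m)) ^ 2) = m := by
  refine Nat.dvd_antisymm (orderOf_dvd_of_pow_eq_one ?_) ?_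
  · refine Equiv.ext fun v => ?_
    simp [reflB_mul_reflC_sq_pow]
  · have h := congrArg (fun e => (e ((0, 0, 1) : ZMod m × ZMod m × ZMod m)).1)
      (pow_orderOf_eq_one ((reflB (ZMod m) * reflC (ZMod m)) ^ 2))
    simp only [reflB_mul_reflC_sq_pow] at h
    rw [← ZMod.natCast_eq_zero_iff]
    simpa using h

theorem orderOf_reflA_mul_reflB (m : ℕ) :
    orderOf (reflA (ZMod m) * reflB (ZMod m)) = m := by
  refine Nat.dvd_antisymm (orderOf_dvd_of_pow_eq_one ?_) ?_
  · refine Equiv.ext fun v => ?_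
    simp [reflA_mul_reflB_pow]
  · have h := congrArg (fun e => (e ((0, 1, 0) : ZMod m × ZMod m × ZMod m)).1)
      (pow_orderOf_eq_one (reflA (ZMod m) * reflB (ZMod m)))
    simp only [reflA_mul_reflB_pow] at h
    rw [← ZMod.natCast_eq_zero_iff]
    simpa using h

end Models

theorem fourSeq_left {G : Type*} [Group G] (i : ℕ) (a b c d : G) :
    fourSeq (i + 1) a b c d i = b := by
  simp [fourSeq]

theorem fourSeq_right {G : Type*} [Group G] (i : ℕ) (a b c d : G) :
    fourSeq (i + 1) a b c d (i + 1) = c := by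
  simp [fourSeq]

/-- A map to signs that changes value only at an edge of even exponent is a representation. -/
theorem isGammaRep_sign {n : ℕ} {p : ℕ → ℕ} {i : ℕ} (hp : Even (p i)) :
    IsGammaRep n p (fun j => if j < i then (-1 : ℤˣ) else 1) where
  sq j _ := Int.units_mul_self _
  edge j _ := by
    by_cases h : j + 1 = i
    · rw [if_pos (by omega), if_neg (by omega), h, mul_one, hp.neg_one_pow]
    · rw [show (if j < i then (-1 : ℤˣ) else 1) = if j + 1 < i then -1 else 1 by
        split_ifs <;> first | rfl | omega, Int.units_mul_self, one_pow]
  far _ _ _ _ := Int.units_sq _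
  tri _ _ := ⟨fun _ _ => Int.units_sq _, fun _ _ => Int.units_sq _, fun _ _ => Int.units_sq _⟩

namespace Gamma

variable {n : ℕ} {p : ℕ → ℕ}

theorem orderOf_map_dvd {G : Type*} [Group G] {f : ℕ → G} (hf : IsGammaRep n p f) {i : ℕ}
    (hi : i + 1 < n) (k : ℕ) :
    orderOf ((f i * f (i + 1)) ^ k) ∣ orderOf ((gen n p i * gen n p (i + 1)) ^ k) := by
  rw [← lift_gen hf hi, ← lift_gen hf (i := i) (by omega), ← map_mul, ← map_pow]
  exact _root_.orderOf_map_dvd _ _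

theorem orderOf_edge_of_odd (hadm : Admissible n p) {i : ℕ} (hi : i + 1 < n)
    (hp : Odd (p (i + 1))) : orderOf (gen n p i * gen n p (i + 1)) = p (i + 1) := by
  refine Nat.dvd_antisymm (orderOf_dvd_of_pow_eq_one ((isGammaRep_gen n p).edge i hi)) ?_
  obtain ⟨⟨ha, hb, -, -⟩, -⟩ := refl_relations (ZMod (p (i + 1)))
  have ho := orderOf_reflA_mul_reflB (p (i + 1))
  set a := reflA (ZMod (p (i + 1)))
  set b := reflB (ZMod (p (i + 1)))
  have hadm' := hadm (i + 1) (by omega) (by omega) hp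
  have hrep : IsGammaRep n p (fourSeq (i + 1) 1 a b 1) := by
    refine isGammaRep_fourSeq hadm (by omega) hi (one_mul 1) ha hb (one_mul 1)
      (by rw [one_mul, sq, hb]) (by rw [mul_one, sq, ha]) (by simp)
      (orderOf_dvd_iff_pow_eq_one.mp ho.dvd)
      (fun h => ?_) (fun h => ?_) (.inl rfl) (.inl rfl) (fun h => ?_) (fun h => ?_)
    · rw [one_mul]; exact pow_eq_one_of_even ha (hadm'.1 h).1
    · rw [mul_one]; exact pow_eq_one_of_even hb (hadm'.2 (by omega)).1
    · exact .one_left (hadm'.1 h).1 ha hb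
    · exact .one_right (hadm'.2 (by omega)).1 ha hb
  have := orderOf_map_dvd hrep hi 1
  rwa [fourSeq_left, fourSeq_right, pow_one, pow_one, ho] at this

theorem orderOf_edge_sq_of_even (hadm : Admissible n p) {i : ℕ} (hi : i + 1 < n)
    (hp : Even (p (i + 1))) :
    orderOf ((gen n p i * gen n p (i + 1)) ^ 2) = p (i + 1) / 2 := by
  obtain ⟨m, hm⟩ := hp.two_dvd
  have hm' : p (i + 1) / 2 = m := by omega
  rw [hm']
  refine Nat.dvd_antisymm (orderOf_dvd_of_pow_eq_one ?_) ?_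
  · rw [← pow_mul, ← hm]; exact (isGammaRep_gen n p).edge i hi
  obtain ⟨⟨ha, hb, hc, hd⟩, ⟨hac, hbd, had⟩, habc, hdcb⟩ := refl_relations (ZMod m)
  have ho := orderOf_reflB_mul_reflC_sq m
  have hab : ∀ k, m ∣ k → (reflA (ZMod m) * reflB (ZMod m)) ^ k = 1 := fun k hk =>
    orderOf_dvd_iff_pow_eq_one.mp ((orderOf_reflA_mul_reflB m).symm ▸ hk)
  have hcd : ∀ k, m ∣ k → (reflC (ZMod m) * reflD (ZMod m)) ^ k = 1 := by
    rintro _ ⟨k, rfl⟩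
    refine Equiv.ext fun v => ?_
    simp [reflC_mul_reflD_pow]
  set a := reflA (ZMod m)
  set b := reflB (ZMod m)
  set c := reflC (ZMod m)
  set d := reflD (ZMod m)
  have hdvd : ∀ k, p (i + 1) ∣ 2 * k → m ∣ k := fun k hk =>
    Nat.dvd_of_mul_dvd_mul_left two_pos (hm ▸ hk)
  have hsq : (b * c) ^ p (i + 1) = 1 := by
    rw [hm, pow_mul]; exact orderOf_dvd_iff_pow_eq_one.mp ho.dvd
  have hrep : IsGammaRep n p (fourSeq (i + 1) (if Odd (p i) then a else 1) b c
      (if Odd (p (i + 2)) then d else 1)) := by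
    refine isGammaRep_fourSeq hadm (by omega) hi ?_ hb hc ?_ ?_ ?_ ?_ hsq (fun h => ?_)
      (fun h => ?_) ?_ ?_ (fun h => ?_) (fun h => ?_)
    · split_ifs <;> first | assumption | exact one_mul 1
    · split_ifs <;> first | assumption | exact one_mul 1
    · split_ifs
      · exact hac
      · rw [one_mul, sq, hc]
    · split_ifs
      · exact hbd
      · rw [mul_one, sq, hb]
    · split_ifs
      · exact had
      · rw [mul_one, sq, ha]
      · rw [one_mul, sq, hd]
      · rw [one_mul, one_pow]
    · split_ifs with h1
      · exact hab _ (hdvd _ ((hadm i (by omega) (by omega) h1).2 (by omega)).2)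
      · rw [one_mul]; exact pow_eq_one_of_even hb (Nat.not_odd_iff_even.mp h1)
    · split_ifs with h1
      · exact hcd _ (hdvd _ ((hadm (i + 2) (by omega) (by omega) h1).1 (by omega)).2)
      · rw [mul_one]; exact pow_eq_one_of_even hc (Nat.not_odd_iff_even.mp h1)
    · simp only [Nat.add_sub_cancel]; split_ifs with h1 <;> simp [h1]
    · split_ifs with h1
      · exact .inr h1
      · exact .inl rfl
    · split_ifs with h1
      · exact ⟨fun h2 _ => absurd h1 (Nat.not_odd_iff_even.mpr h2), fun _ _ => habc,
          fun _ h2 => absurd hp (Nat.not_even_iff_odd.mpr h2)⟩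
      · exact .one_left (Nat.not_odd_iff_even.mp h1) hb hc
    · split_ifs with h1
      · exact ⟨fun _ h2 => absurd h1 (Nat.not_odd_iff_even.mpr h2),
          fun h2 => absurd hp (Nat.not_even_iff_odd.mpr h2), fun _ _ => hdcb⟩
      · exact .one_right (Nat.not_odd_iff_even.mp h1) hb hc
  have := orderOf_map_dvd hrep hi 2
  rwa [fourSeq_left, fourSeq_right, ho] at this

theorem orderOf_edge_of_even (hadm : Admissible n p) {i : ℕ} (hi : i + 1 < n)
    (hp : Even (p (i + 1))) : orderOf (gen n p i * gen n p (i + 1)) = p (i + 1) := by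
  have h2 : 2 ∣ orderOf (gen n p i * gen n p (i + 1)) := by
    have := orderOf_map_dvd (isGammaRep_sign (n := n) hp) hi 1
    rw [if_pos (by omega), if_neg (by omega), mul_one, pow_one, pow_one] at this
    rwa [orderOf_eq_prime (p := 2) (by simp) (by decide)] at this
  have h := orderOf_edge_sq_of_even hadm hi hp
  rw [orderOf_pow_of_dvd two_ne_zero h2] at h
  have := hp.two_dvd
  omega

theorem orderOf_edge (hadm : Admissible n p) {i : ℕ} (hi : i + 1 < n) :
    orderOf (gen n p i * gen n p (i + 1)) = p (i + 1) :=
  (Nat.even_or_odd _).elim (orderOf_edge_of_even hadm hi) (orderOf_edge_of_odd hadm hi)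

theorem card_one (p : ℕ → ℕ) : Nat.card (Gamma 1 p) = 2 := by
  have htop : Subgroup.zpowers (gen 1 p 0) = ⊤ := by
    refine eq_top_iff.mpr fun g _ => mem_of_gen _ (fun j hj => ?_) g
    obtain rfl : j = 0 := by omega
    exact Subgroup.mem_zpowers _
  have hrep : IsGammaRep 1 p (fun _ => (-1 : ℤˣ)) :=
    ⟨fun _ _ => by simp, fun _ _ => by simp, fun _ _ _ _ => by simp,
      fun _ _ => ⟨by simp, by simp, by simp⟩⟩
  rw [← Subgroup.card_top, ← htop, Nat.card_zpowers]
  refine orderOf_eq_prime (by rw [sq]; exact (isGammaRep_gen 1 p).sq 0 one_pos) fun h => ?_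
  have := lift_gen hrep one_pos
  rw [h, map_one] at this
  exact absurd this (by decide)

theorem card_two (hadm : Admissible 2 p) :
    Nat.card (Gamma 2 p) = 2 * p 1 := by
  have ho := orderOf_edge hadm (i := 0) one_lt_two
  have h := isGammaRep_gen 2 p
  have hrep : IsGammaRep 2 p (fun _ => (-1 : ℤˣ)) :=
    ⟨fun _ _ => by simp, fun _ _ => by simp, fun _ _ _ _ => by simp,
      fun _ _ => ⟨by simp, by simp, by simp⟩⟩
  set x := gen 2 p 0
  set z := gen 2 p 1
  have hx : x * x = 1 := h.sq 0 two_pos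
  have hz : z * z = 1 := h.sq 1 one_lt_two
  have hx' : x⁻¹ = x := inv_eq_of_mul_eq_one_right hx
  have hz' : z⁻¹ = z := inv_eq_of_mul_eq_one_right hz
  set N := Subgroup.zpowers (x * z) with hN
  have hconj : ∀ g ∈ N, x * g * x ∈ N := by
    rintro _ ⟨k, rfl⟩
    refine ⟨-k, ?_⟩
    have : x * (x * z) ^ k * x⁻¹ = (x * z) ^ (-k) := by
      rw [← conj_zpow, zpow_neg, ← inv_zpow, mul_inv_rev, hx', hz', ← mul_assoc, hx, one_mul]
    exact (this.symm.trans (by rw [hx']))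
  let S : Subgroup (Gamma 2 p) :=
    { carrier := {g | g ∈ N ∨ g * x ∈ N}
      one_mem' := .inl N.one_mem
      mul_mem' := by
        rintro g k (hg | hg) (hk | hk)
        · exact .inl (N.mul_mem hg hk)
        · exact .inr (by rw [mul_assoc]; exact N.mul_mem hg hk)
        · right
          have := N.mul_mem hg (hconj _ hk)
          rwa [show g * x * (x * k * x) = g * (x * x) * k * x by group, hx, mul_one] at this
        · left
          have := N.mul_mem hg (hconj _ hk)
          rwa [show g * x * (x * (k * x) * x) = g * (x * x) * k * (x * x) by group, hx, mul_one,
            mul_one] at this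
      inv_mem' := by
        rintro g (hg | hg)
        · exact .inl (N.inv_mem hg)
        · right
          have := hconj _ (N.inv_mem hg)
          rwa [mul_inv_rev, ← mul_assoc, mul_inv_cancel, one_mul] at this }
  have hS : ∀ g, g ∈ N ∨ g * x ∈ N := mem_of_gen S fun j hj => by
    interval_cases j
    · exact .inr (hx ▸ N.one_mem)
    · right
      have := N.inv_mem (Subgroup.mem_zpowers (x * z))
      rwa [mul_inv_rev, hx', hz'] at this
  have hker : N ≤ (lift hrep).ker := by
    rw [hN, Subgroup.zpowers_le, MonoidHom.mem_ker, map_mul, lift_gen hrep two_pos,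
      lift_gen hrep one_lt_two]
    rfl
  have hindex : N.index = 2 := by
    refine Subgroup.index_eq_two_iff_exists_notMem_and.mpr ⟨x, fun hxN => ?_, fun g => (hS g).symm⟩
    have h3 := hker hxN
    rw [MonoidHom.mem_ker, lift_gen hrep two_pos] at h3
    exact absurd h3 (by decide)
  rw [← N.index_mul_card, hindex, Nat.card_zpowers]
  exact congrArg (2 * ·) ho

theorem card_eq (n : ℕ) (p : ℕ → ℕ) (hadm : Admissible (n + 1) p) :
    Nat.card (Gamma (n + 1) p) = 2 * ∏ k ∈ Finset.range n, p (k + 1) := by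
  induction n using Nat.strong_induction_on generalizing p with
  | _ n ih =>
  by_cases h : ∃ i < n, Even (p (i + 1))
  · obtain ⟨i, hi, hp⟩ := h
    obtain ⟨m, rfl⟩ : ∃ m, n = i + 1 + m := ⟨n - (i + 1), by omega⟩
    have h1 : Admissible (i + 1) p := fun k hk hk' ho =>
      ⟨(hadm k hk (by omega) ho).1, fun h => (hadm k hk (by omega) ho).2 (by omega)⟩
    have h2 : Admissible (m + 1) (fun k => p (i + 1 + k)) := fun k hk hk' ho =>
      ⟨fun h => by
        have := (hadm _ (by omega) (by omega) ho).1 (by omega)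
        rwa [show i + 1 + k - 1 = i + 1 + (k - 1) by omega] at this,
      fun h => (hadm _ (by omega) (by omega) ho).2 (by omega)⟩
    have hs := card_split (m := m + 1) (by omega) hp
    have ho := orderOf_edge_sq_of_even hadm (i := i) (by omega) hp
    rw [← add_assoc] at hs
    rw [hs, ih i (by omega) p h1, ih m (by omega) _ h2, ho, Finset.prod_range_add,
      Finset.prod_range_succ]
    obtain ⟨r, hr⟩ := hp.two_dvd
    rw [hr, Nat.mul_div_cancel_left _ two_pos]
    simp only [add_assoc]
    ring
  · push Not at h
    have hn : n < 2 := by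
      by_contra hn
      have h0 := h 0 (by omega)
      have := (hadm 1 le_rfl (by omega) (Nat.not_even_iff_odd.mp h0)).2 (by omega)
      exact h 1 (by omega) this.1
    interval_cases n
    · simpa using card_one p
    · simpa using card_two hadm

end Gamma

/-- Let `(p_1, …, p_{n-1})` be an admissible tuple, and let `q_i` be the order of
`x_{i-1} x_i` in `Γ(p_1, …, p_{n-1})`. Then `q_i = p_i` whenever `p_i` is odd, the order of
`Γ(p_1, …, p_{n-1})` equals `2 q_1 ⋯ q_{n-1}`, and in particular it divides
`2 p_1 ⋯ p_{n-1}`. -/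
theorem gamma_card_eq_prod_orders (n : ℕ) (hn : 3 ≤ n) (p : ℕ → ℕ)
    (hp : ∀ k : ℕ, 1 ≤ k → k ≤ n - 1 → 2 ≤ p k)
    (hadm : Admissible n p) :
    (∀ i j : Fin n, (i : ℕ) + 1 = (j : ℕ) → Odd (p (j : ℕ)) →
        orderOf (xg n p i * xg n p j) = p (j : ℕ)) ∧
    Nat.card (Gamma n p) = 2 * ∏ k ∈ Finset.Icc 1 (n - 1),
      (if h : k < n then orderOf (xg n p ⟨k - 1, by omega⟩ * xg n p ⟨k, h⟩) else 1) ∧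
    Nat.card (Gamma n p) ∣ 2 * ∏ k ∈ Finset.Icc 1 (n - 1), p k := by
  have hedge : ∀ i j : Fin n, (i : ℕ) + 1 = (j : ℕ) →
      orderOf (xg n p i * xg n p j) = p (j : ℕ) := by
    rintro ⟨i, hi⟩ ⟨j, hj⟩ h
    dsimp only at h
    subst h
    simpa [Gamma.gen, hi, hj] using Gamma.orderOf_edge hadm hj
  obtain ⟨m, rfl⟩ : ∃ m, n = m + 1 := ⟨n - 1, by omega⟩
  have hcard : Nat.card (Gamma (m + 1) p) = 2 * ∏ k ∈ Finset.Icc 1 m, p k := by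
    rw [Gamma.card_eq m p hadm, ← Finset.Ico_add_one_right_eq_Icc, Finset.prod_Ico_eq_prod_range]
    simp [add_comm]
  refine ⟨fun i j h _ => hedge i j h, ?_, hcard.dvd⟩
  rw [hcard]
  congr 1
  refine Finset.prod_congr rfl fun k hk => ?_
  have hk' := Finset.mem_Icc.mp hk
  rw [dif_pos (by omega), hedge]
  dsimp only
  omega
end
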